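/- arXiv:1106.6254 — 2 statements merged into one kernel-verified Lean document; each statement's English description precedes it below -/
import Mathlib

section
/- Under the Cayley setup, for all 0 ≤ k ≤ d+1: h_k(F) ≤ binom(n1+n2−d−2+k, k) − binom(n1−d−2+k, k) − binom(n2−d−2+k, k). Moreover, equality holds for all k with 0 ≤ k ≤ l if and only if l ≤ ⌊(d+1)/2⌋ and P is (V1; l)-bineighborly, where V1 is the vertex set of P1. -/
open Set Pointwise

noncomputable section

/-- Euclidean `d`-space `E^d`, modeled as `Fin d → ℝ`. -/
abbrev Euc (d : ℕ) : Type := Fin d → ℝ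

/-- The (affine) dimension of a subset of Euclidean space: the dimension of its affine hull. -/
def setDim {d : ℕ} (F : Set (Euc d)) : ℕ :=
  Module.finrank ℝ (affineSpan ℝ F).direction

/-- A (convex) polytope: the convex hull of a finite point set. -/
def IsPolytope {d : ℕ} (P : Set (Euc d)) : Prop :=
  ∃ S : Set (Euc d), S.Finite ∧ P = convexHull ℝ S

/-- `F` is a proper (nonempty) face of `P`: `F` is an exposed face of `P` (the intersection
of `P` with a supporting hyperplane) which is nonempty and different from `P` itself. -/
def IsProperFaceOf {d : ℕ} (P F : Set (Euc d)) : Prop :=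
  IsExposed ℝ P F ∧ F ≠ P ∧ F.Nonempty

/-- The vertex set of a polytope: its set of extreme points. -/
def vertSet {d : ℕ} (P : Set (Euc d)) : Set (Euc d) :=
  Set.extremePoints ℝ P

/-- The number of vertices of a polytope. -/
def vertCount {d : ℕ} (P : Set (Euc d)) : ℕ := (vertSet P).ncard

/-- `faceCount P k` is `f_k(P)`, the number of `k`-dimensional (proper) faces of `P`. -/
def faceCount {d : ℕ} (P : Set (Euc d)) (k : ℕ) : ℕ :=
  {F : Set (Euc d) | IsProperFaceOf P F ∧ setDim F = k}.ncard

/-- The moment curve `t ↦ (t, t², …, t^δ)` in `E^δ`. -/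
def momentCurve (δ : ℕ) (t : ℝ) : Euc δ := fun i => t ^ ((i : ℕ) + 1)

/-- A standard realization of the cyclic `δ`-polytope `C_δ(n)` with `n` vertices:
the convex hull of `n` distinct points on the moment curve. -/
def cyclicPolytope (δ n : ℕ) : Set (Euc δ) :=
  convexHull ℝ (momentCurve δ '' (Set.range fun j : Fin n => (j : ℝ) + 1))

/-- `S` is the vertex set of a proper face of `P` of dimension `|S| - 1`. -/
def IsSimplexFaceVertexSet {d : ℕ} (P S : Set (Euc d)) : Prop :=
  ∃ F : Set (Euc d), IsProperFaceOf P F ∧ vertSet F = S ∧ setDim F + 1 = S.ncard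

/-- A polytope `P` is `(V1; k)`-bineighborly: `V1` is a nonempty proper subset of the vertex
set of `P`, and for all nonempty `S1 ⊆ V1` and `S2 ⊆ V ∖ V1` with `|S1| + |S2| ≤ k`,
the set `S1 ∪ S2` is the vertex set of a face of `P` of dimension `|S1| + |S2| - 1`. -/
def PolytopeBineighborly {d : ℕ} (P V1 : Set (Euc d)) (k : ℕ) : Prop :=
  V1.Nonempty ∧ V1 ⊂ vertSet P ∧
    ∀ S1 S2 : Set (Euc d), S1.Nonempty → S2.Nonempty →
      S1 ⊆ V1 → S2 ⊆ vertSet P \ V1 → S1.ncard + S2.ncard ≤ k →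
        IsSimplexFaceVertexSet P (S1 ∪ S2)

/-- A polytope is `k`-neighborly if every nonempty subset of at most `k` of its vertices is
the vertex set of a face. -/
def PolytopeNeighborly {d : ℕ} (P : Set (Euc d)) (k : ℕ) : Prop :=
  ∀ S : Set (Euc d), S ⊆ vertSet P → S.Nonempty → S.ncard ≤ k →
    ∃ F : Set (Euc d), IsProperFaceOf P F ∧ vertSet F = S

/-- Embed `E^d` into the hyperplane `{x_{d+1} = c}` of `E^{d+1}`. -/
def lift {d : ℕ} (c : ℝ) (x : Euc d) : Euc (d + 1) := Fin.snoc x c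

/-- The Cayley polytope `CH_{d+1}({P1, P2})` of `P1` embedded in `{x_{d+1} = 0}` and
`P2` embedded in `{x_{d+1} = 1}`. -/
def cayley {d : ℕ} (P1 P2 : Set (Euc d)) : Set (Euc (d + 1)) :=
  convexHull ℝ (lift 0 '' P1 ∪ lift 1 '' P2)

/-- `ubTerm n d k = binom (n - d - 2 + k) k` (equal to the true binomial for `n ≥ d + 1`). -/
def ubTerm (n d k : ℕ) : ℕ := (n + k - (d + 2)).choose k

/-- The upper bound for `f_{k-1}(P1 ⊕ P2)`:
`f_k(C_{d+1}(n1+n2)) - ∑_{i=0}^{⌊(d+1)/2⌋} binom(d+1-i, k+1-i) (binom(n1-d-2+i, i) + binom(n2-d-2+i, i))`. -/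
def minkBound (d n1 n2 k : ℕ) : ℤ :=
  (faceCount (cyclicPolytope (d + 1) (n1 + n2)) k : ℤ)
    - ∑ i ∈ Finset.range ((d + 1) / 2 + 1),
        (if i ≤ k + 1 then ((d + 1 - i).choose (k + 1 - i) : ℤ) else 0)
          * ((ubTerm n1 d i : ℤ) + (ubTerm n2 d i : ℤ))

/-- A polytopal complex in `E^N`: a finite nonempty collection of polytopes containing `∅`,
closed under taking faces, such that pairwise intersections are faces of both. -/
structure PolyComplex (N : ℕ) where
  faces : Set (Set (Euc N))
  finite_faces : faces.Finite
  empty_mem : ∅ ∈ faces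
  polytope_mem : ∀ F ∈ faces, IsPolytope F
  down_closed : ∀ F ∈ faces, ∀ G : Set (Euc N), IsExposed ℝ F G → G ∈ faces
  inter_face : ∀ F ∈ faces, ∀ G ∈ faces, IsExposed ℝ F (F ∩ G) ∧ IsExposed ℝ G (F ∩ G)

namespace PolyComplex

/-- The vertex set of a complex: its `0`-dimensional faces. -/
def verts {N : ℕ} (C : PolyComplex N) : Set (Euc N) := {v : Euc N | {v} ∈ C.faces}

/-- `C` is a (pure-dimension-bounded) `d`-complex: all faces have dimension at most `d`
and some face has dimension exactly `d`. -/
def IsDComplex {N : ℕ} (C : PolyComplex N) (d : ℕ) : Prop :=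
  (∀ F ∈ C.faces, setDim F ≤ d) ∧ ∃ F ∈ C.faces, setDim F = d

/-- A complex `C` is `(V1; k)`-bineighborly. -/
def Bineighborly {N : ℕ} (C : PolyComplex N) (V1 : Set (Euc N)) (k : ℕ) : Prop :=
  V1.Nonempty ∧ V1 ⊂ C.verts ∧
    ∀ S1 S2 : Set (Euc N), S1.Nonempty → S2.Nonempty →
      S1 ⊆ V1 → S2 ⊆ C.verts \ V1 → S1.ncard + S2.ncard ≤ k →
        ∃ F ∈ C.faces, vertSet F = S1 ∪ S2 ∧ setDim F + 1 = S1.ncard + S2.ncard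

/-- A complex is `k`-neighborly if every nonempty subset of at most `k` of its vertices is
the vertex set of a face. -/
def Neighborly {N : ℕ} (C : PolyComplex N) (k : ℕ) : Prop :=
  ∀ S : Set (Euc N), S ⊆ C.verts → S.Nonempty → S.ncard ≤ k →
    ∃ F ∈ C.faces, vertSet F = S

end PolyComplex

/-- `F` is a simplex: the convex hull of an affinely independent finite point set. -/
def IsSimplexSet {d : ℕ} (F : Set (Euc d)) : Prop :=
  ∃ S : Finset (Euc d),
    AffineIndependent ℝ (fun v : {x // x ∈ S} => (v : Euc d)) ∧
      F = convexHull ℝ (S : Set (Euc d))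

/-- A simplicial polytope: all its proper faces are simplices. -/
def IsSimplicialPolytope {d : ℕ} (P : Set (Euc d)) : Prop :=
  IsPolytope P ∧ ∀ F : Set (Euc d), IsProperFaceOf P F → IsSimplexSet F

/-- The collection `𝓕` of proper faces of the Cayley polytope of `P1`, `P2` having at least one
vertex in (the embedded copy of) each of `P1` and `P2`. -/
def cayleyFaces {d : ℕ} (P1 P2 : Set (Euc d)) : Set (Set (Euc (d + 1))) :=
  {F : Set (Euc (d + 1)) | IsProperFaceOf (cayley P1 P2) F ∧
    (vertSet F ∩ lift 0 '' P1).Nonempty ∧ (vertSet F ∩ lift 1 '' P2).Nonempty}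

/-- `fFm1 P1 P2 k = f_{k-1}(𝓕)`, with the convention `f_{-1}(𝓕) = -1`. -/
def fFm1 {d : ℕ} (P1 P2 : Set (Euc d)) : ℕ → ℤ
  | 0 => -1
  | (k + 1) => (({F ∈ cayleyFaces P1 P2 | setDim F = k} : Set (Set (Euc (d + 1)))).ncard : ℤ)

/-- The `h`-vector of `𝓕`: `h_k(𝓕) = ∑_{i=0}^{k} (-1)^{k-i} binom(d+1-i, d+1-k) f_{i-1}(𝓕)`. -/
def hF {d : ℕ} (P1 P2 : Set (Euc d)) (k : ℕ) : ℤ :=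
  ∑ i ∈ Finset.range (k + 1),
    (-1 : ℤ) ^ (k - i) * ((d + 1 - i).choose (d + 1 - k) : ℤ) * fFm1 P1 P2 i

/-- `fBdm1 P k = f_{k-1}(∂P)`, with `f_{-1}(∂P) = 1`. -/
def fBdm1 {d : ℕ} (P : Set (Euc d)) : ℕ → ℤ
  | 0 => 1
  | (k + 1) => (faceCount P k : ℤ)

/-- The `h`-vector of the boundary complex of a `d`-polytope `P ⊆ E^d`:
`h_k(∂P) = ∑_{i=0}^{k} (-1)^{k-i} binom(d-i, d-k) f_{i-1}(∂P)`. -/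
def hBd {d : ℕ} (P : Set (Euc d)) (k : ℕ) : ℤ :=
  ∑ i ∈ Finset.range (k + 1),
    (-1 : ℤ) ^ (k - i) * ((d - i).choose (d - k) : ℤ) * fBdm1 P i

/-- The `g`-vector of `∂P`: `g_0 = h_0 (= 1)` and `g_k = h_k - h_{k-1}`, with the
convention `h_{d+1}(∂P) = 0`. -/
def gBd {d : ℕ} (P : Set (Euc d)) (k : ℕ) : ℤ :=
  (if k ≤ d then hBd P k else 0)
    - (if k = 0 then 0 else if k - 1 ≤ d then hBd P (k - 1) else 0)

/-- `fCycm1 δ n k = f_{k-1}(C_δ(n))`, with `f_{-1} = 1`. -/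
def fCycm1 (δ n k : ℕ) : ℤ :=
  if k = 0 then 1 else (faceCount (cyclicPolytope δ n) (k - 1) : ℤ)

/-- The upper bound for `f_{k-1}(𝓕)`:
`f_{k-1}(C_{d+1}(n1+n2)) - ∑_{i=0}^{⌊(d+1)/2⌋} binom(d+1-i, k-i)(binom(n1-d-2+i,i)+binom(n2-d-2+i,i))`. -/
def cayleyBound (d n1 n2 k : ℕ) : ℤ :=
  fCycm1 (d + 1) (n1 + n2) k
    - ∑ i ∈ Finset.range ((d + 1) / 2 + 1),
        (if i ≤ k then ((d + 1 - i).choose (k - i) : ℤ) else 0)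
          * ((ubTerm n1 d i : ℤ) + (ubTerm n2 d i : ℤ))

/-- The moment-like curve `γ1(t; ζ) = (t, ζ t^d, t², t³, …, t^{d-1}, 0)` in `E^{d+1}`. -/
def gamma1 (d : ℕ) (ζ t : ℝ) : Euc (d + 1) := fun i =>
  if (i : ℕ) = 0 then t
  else if (i : ℕ) = 1 then ζ * t ^ d
  else if (i : ℕ) = d then 0
  else t ^ (i : ℕ)

/-- The moment-like curve `γ2(s; ζ) = (ζ s^d, s, s², s³, …, s^{d-1}, 1)` in `E^{d+1}`. -/
def gamma2 (d : ℕ) (ζ s : ℝ) : Euc (d + 1) := fun i =>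
  if (i : ℕ) = 0 then ζ * s ^ d
  else if (i : ℕ) = 1 then s
  else if (i : ℕ) = d then 1
  else s ^ (i : ℕ)

/-- The `(k+ℓ) × (k+ℓ)` matrix whose determinant is `D_{k,ℓ}(τ)`: rows are
`(1,…,1,0,…,0)`, `(x₁τ,…,x_kτ,0,…,0)`, `(0,…,0,1,…,1)`, `(0,…,0,y₁,…,y_ℓ)` and
`(x₁^pτ^p,…,x_k^pτ^p,y₁^p,…,y_ℓ^p)` for `p = 2, …, k+ℓ-3`. -/
def Dmat (k l : ℕ) (x : Fin k → ℝ) (y : Fin l → ℝ) (τ : ℝ) :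
    Matrix (Fin (k + l)) (Fin (k + l)) ℝ :=
  Matrix.of fun r c =>
    have hcl : (c : ℕ) < k + l := c.isLt
    if hc : (c : ℕ) < k then
      if (r : ℕ) = 0 then 1
      else if (r : ℕ) = 1 then x ⟨(c : ℕ), hc⟩ * τ
      else if (r : ℕ) = 2 then 0
      else if (r : ℕ) = 3 then 0
      else (x ⟨(c : ℕ), hc⟩ * τ) ^ ((r : ℕ) - 2)
    else
      have hck : (c : ℕ) - k < l := by omega
      if (r : ℕ) = 0 then 0
      else if (r : ℕ) = 1 then 0
      else if (r : ℕ) = 2 then 1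
      else if (r : ℕ) = 3 then y ⟨(c : ℕ) - k, hck⟩
      else y ⟨(c : ℕ) - k, hck⟩ ^ ((r : ℕ) - 2)

/-- The exponent vector `μ = (0, 1, k, k+1, …, k+ℓ-3)`. -/
def muExp (k i : ℕ) : ℕ := if i = 0 then 0 else if i = 1 then 1 else k + i - 2

/-- The Vandermonde determinant `VD(x) = ∏_{i<j} (x_j - x_i)`. -/
def VDprod {k : ℕ} (x : Fin k → ℝ) : ℝ :=
  ∏ p ∈ Finset.univ.filter (fun p : Fin k × Fin k => p.1 < p.2), (x p.2 - x p.1)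

/-- The generalized Vandermonde determinant `GVD(y; μ) = det (y_j^{μ_i})` with exponent
vector `μ = (0, 1, k, k+1, …, k+ℓ-3)`. -/
def GVDdet (k : ℕ) {l : ℕ} (y : Fin l → ℝ) : ℝ :=
  (Matrix.of fun i j : Fin l => y j ^ muExp k (i : ℕ)).det

/-- `binom(a, b)` for an integer lower index, zero when `b < 0` or `b > a`. -/
def zchoose (a : ℕ) (b : ℤ) : ℝ := if 0 ≤ b then (a.choose b.toNat : ℝ) else 0

/-- The `h`-vector transform in dimension `D` of a sequence `f` (with `f i` standing for
`f_{i-1}`). -/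
def hvec (D : ℕ) (f : ℕ → ℤ) (k : ℕ) : ℤ :=
  ∑ i ∈ Finset.range (k + 1), (-1 : ℤ) ^ (k - i) * ((D - i).choose (D - k) : ℤ) * f i

lemma hvec_congr {D k : ℕ} {f g : ℕ → ℤ} (h : ∀ i ≤ k, f i = g i) : hvec D f k = hvec D g k := by
  unfold hvec
  refine Finset.sum_congr rfl fun i hi => ?_
  rw [h i (by simpa [Nat.lt_succ_iff] using hi)]

lemma hvec_add (D k : ℕ) (f g : ℕ → ℤ) :
    hvec D (fun i => f i + g i) k = hvec D f k + hvec D g k := by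
  simp only [hvec, mul_add, Finset.sum_add_distrib]

lemma hvec_sub (D k : ℕ) (f g : ℕ → ℤ) :
    hvec D (fun i => f i - g i) k = hvec D f k - hvec D g k := by
  simp only [hvec, mul_sub, Finset.sum_sub_distrib]

lemma hvec_sum {α : Type*} (D k : ℕ) (s : Finset α) (f : α → ℕ → ℤ) :
    hvec D (fun i => ∑ a ∈ s, f a i) k = ∑ a ∈ s, hvec D (f a) k := by
  simp only [hvec, Finset.mul_sum]
  exact Finset.sum_comm

lemma hvec_const_mul (D k : ℕ) (c : ℤ) (f : ℕ → ℤ) :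
    hvec D (fun i => c * f i) k = c * hvec D f k := by
  simp only [hvec, Finset.mul_sum]
  exact Finset.sum_congr rfl fun i _ => by ring

lemma hvec_zero (D : ℕ) (f : ℕ → ℤ) : hvec D f 0 = f 0 := by simp [hvec]

/-- The `h`-vector of a single interval `[R, F]` in the Boolean lattice. -/
lemma hvec_interval {D r k : ℕ} (hk : k ≤ D) :
    hvec D (fun i => if r ≤ i then ((D - r).choose (i - r) : ℤ) else 0) k
      = if r = k then 1 else 0 := by
  unfold hvec
  rcases lt_or_ge k r with hkr | hrk
  · rw [if_neg (by omega)]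
    refine Finset.sum_eq_zero fun i hi => ?_
    rw [Finset.mem_range] at hi
    simp [show ¬ r ≤ i by omega]
  · obtain ⟨m, rfl⟩ := Nat.exists_eq_add_of_le hrk
    rw [show r + m + 1 = r + (m + 1) by ring, Finset.sum_range_add]
    rw [Finset.sum_eq_zero (s := Finset.range r), zero_add]
    · have key : ∀ j ∈ Finset.range (m + 1),
          (-1 : ℤ) ^ (r + m - (r + j)) * ((D - (r + j)).choose (D - (r + m)) : ℤ) *
            (if r ≤ r + j then ((D - r).choose (r + j - r) : ℤ) else 0)
          = ((D - r).choose m : ℤ) * (-1) ^ m * ((-1 : ℤ) ^ j * (m.choose j : ℤ)) := by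
        intro j hj
        rw [Finset.mem_range] at hj
        have hjm : j ≤ m := by omega
        rw [if_pos (by omega), show r + m - (r + j) = m - j by omega,
          show r + j - r = j by omega]
        have h1 : (D - r).choose m * m.choose j = (D - r).choose j * (D - r - j).choose (m - j) :=
          Nat.choose_mul (by omega)
        have h2 : (D - (r + j)).choose (D - (r + m)) = (D - r - j).choose (m - j) := by
          rw [show D - (r + j) = D - r - j by omega]
          rw [← Nat.choose_symm (show m - j ≤ D - r - j by omega)]
          congr 1; omega
        have h3 : (-1 : ℤ) ^ (m - j) = (-1) ^ m * (-1) ^ j := by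
          rw [← pow_add, show m + j = (m - j) + 2 * j by omega, pow_add, pow_mul]; simp
        rw [h2, h3]
        have h1' : ((D - r).choose m : ℤ) * m.choose j
            = (D - r).choose j * (D - r - j).choose (m - j) := by exact_mod_cast h1
        linear_combination (-1 : ℤ) ^ m * (-1) ^ j * (-h1')
      rw [Finset.sum_congr rfl key, ← Finset.mul_sum, Int.alternating_sum_range_choose]
      by_cases hm : m = 0
      · subst hm; simp
      · simp [hm]
    · intro i hi
      rw [Finset.mem_range] at hi
      simp [show ¬ r ≤ i by omega]

/-- Pascal's rule for `h`-vectors: raising the dimension by one takes differences. -/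
lemma hvec_succ_dim {D k : ℕ} (hk : k + 1 ≤ D) (f : ℕ → ℤ) :
    hvec (D + 1) f (k + 1) = hvec D f (k + 1) - hvec D f k := by
  unfold hvec
  rw [Finset.sum_range_succ, Finset.sum_range_succ _ (k + 1), add_sub_right_comm,
    ← Finset.sum_sub_distrib]
  congr 1
  · refine Finset.sum_congr rfl fun i hi => ?_
    rw [Finset.mem_range] at hi
    have h1 : (D + 1 - i).choose (D + 1 - (k + 1))
        = (D - i).choose (D - (k + 1)) + (D - i).choose (D - k) := by
      rw [show D + 1 - i = (D - i) + 1 by omega, show D + 1 - (k + 1) = (D - (k + 1)) + 1 by omega,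
        Nat.choose_succ_succ, show (D - (k + 1)).succ = D - k by omega]
    rw [h1, show k + 1 - i = (k - i) + 1 by omega, pow_succ]
    push_cast
    ring
  · simp

/-- The derivation identity relating the `h`-vector of a family to those of its links. -/
lemma hvec_derivative {D k : ℕ} (hk : k ≤ D) (f : ℕ → ℤ) :
    hvec D (fun i => ((i : ℤ) + 1) * f (i + 1)) k
      = (k + 1) * hvec (D + 1) f (k + 1) + (D + 1 - k) * hvec (D + 1) f k := by
  unfold hvec
  rw [Finset.sum_range_succ' _ (k + 1), Finset.sum_range_succ' (n := k)
    (f := fun i => (-1 : ℤ) ^ (k - i) * ((D + 1 - i).choose (D + 1 - k) : ℤ) * f i)]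
  rw [Finset.sum_range_succ _ k, Finset.sum_range_succ _ k]
  have h0 : ((k : ℤ) + 1) * ((D + 1).choose (D - k) : ℤ)
      = (D + 1 - k) * (D + 1).choose (D + 1 - k) := by
    have := Nat.choose_succ_right_eq (D + 1) k
    rw [← Nat.choose_symm (show k + 1 ≤ D + 1 by omega),
      ← Nat.choose_symm (show k ≤ D + 1 by omega),
      show D + 1 - (k + 1) = D - k by omega] at this
    have h := congrArg (Nat.cast : ℕ → ℤ) this
    push_cast [Nat.cast_sub (show k ≤ D + 1 by omega)] at h
    linear_combination h
  have hs : ∀ i ∈ Finset.range k,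
      (-1 : ℤ) ^ (k - i) * ((D - i).choose (D - k) : ℤ) * (((i : ℤ) + 1) * f (i + 1))
      = (k + 1) * ((-1 : ℤ) ^ (k + 1 - (i + 1)) * ((D + 1 - (i + 1)).choose (D + 1 - (k + 1)) : ℤ)
          * f (i + 1))
        + (D + 1 - k) * ((-1 : ℤ) ^ (k - (i + 1)) * ((D + 1 - (i + 1)).choose (D + 1 - k) : ℤ)
          * f (i + 1)) := by
    intro i hi
    rw [Finset.mem_range] at hi
    have := Nat.choose_succ_right_eq (D - i) (k - (i + 1))
    rw [show k - (i + 1) + 1 = k - i by omega,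
      ← Nat.choose_symm (show k - i ≤ D - i by omega),
      ← Nat.choose_symm (show k - (i + 1) ≤ D - i by omega),
      show D - i - (k - i) = D - k by omega,
      show D - i - (k - (i + 1)) = D + 1 - k by omega] at this
    have h := congrArg (Nat.cast : ℕ → ℤ) this
    push_cast [Nat.cast_sub (show i ≤ k by omega), Nat.cast_sub (show k ≤ D + 1 by omega)] at h
    rw [show k + 1 - (i + 1) = k - i by omega, show D + 1 - (i + 1) = D - i by omega,
      show D + 1 - (k + 1) = D - k by omega, show k - i = (k - (i + 1)) + 1 by omega, pow_succ]
    linear_combination (-1 : ℤ) ^ (k - (i + 1)) * f (i + 1) * h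
  rw [Finset.sum_congr rfl hs, Finset.sum_add_distrib, ← Finset.mul_sum, ← Finset.mul_sum]
  simp only [Nat.sub_self, pow_zero, Nat.choose_self, Nat.sub_zero,
    show D + 1 - (k + 1) = D - k by omega, pow_succ]
  push_cast
  linear_combination (-1 : ℤ) ^ k * f 0 * h0

/-- The `h`-vector of the sequence of all subsets of an `n`-set. -/
lemma hvec_choose {D n k : ℕ} (hk : k ≤ D) (hn : D ≤ n) :
    hvec D (fun i => (n.choose i : ℤ)) k = ((n + k - (D + 1)).choose k : ℤ) := by
  induction k generalizing D n with
  | zero => simp [hvec]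
  | succ k ih =>
    obtain ⟨D, rfl⟩ : ∃ E, D = E + 1 := ⟨D - 1, by omega⟩
    obtain ⟨n, rfl⟩ : ∃ m, n = m + 1 := ⟨n - 1, by omega⟩
    have h1 := hvec_derivative (D := D) (k := k) (by omega) (fun i => ((n + 1).choose i : ℤ))
    have h2 : hvec D (fun i => ((i : ℤ) + 1) * ((n + 1).choose (i + 1) : ℤ)) k
        = (n + 1) * ((n + k - (D + 1)).choose k : ℤ) := by
      rw [← ih (by omega) (by omega : D ≤ n), ← hvec_const_mul]
      refine hvec_congr fun i _ => ?_
      have := Nat.add_one_mul_choose_eq n i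
      have h := congrArg (Nat.cast : ℕ → ℤ) this
      push_cast at h
      linear_combination -h
    have h3 := ih (D := D + 1) (n := n + 1) (by omega) (by omega)
    rw [h2, h3, show n + 1 + k - (D + 1 + 1) = n + k - (D + 1) by omega] at h1
    rw [show n + 1 + (k + 1) - (D + 1 + 1) = n + k - D by omega]
    have h4 : ((k : ℤ) + 1) * ((n + k - D).choose (k + 1) : ℤ)
        = (n + k - D) * ((n + k - (D + 1)).choose k : ℤ) := by
      rcases Nat.eq_zero_or_pos (n + k - D) with h0 | h0
      · have h5 : ((n : ℤ) + k - D) = 0 := by omega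
        rw [h0, h5]; simp
      · obtain ⟨m, hm⟩ : ∃ m, n + k - D = m + 1 := ⟨n + k - D - 1, by omega⟩
        rw [hm, show n + k - (D + 1) = m by omega, show ((n : ℤ) + k - D) = m + 1 by omega]
        have h := congrArg (Nat.cast : ℕ → ℤ) (Nat.add_one_mul_choose_eq m k)
        push_cast at h
        linear_combination -h
    have h6 : ((k : ℤ) + 1) ≠ 0 := by positivity
    apply mul_left_cancel₀ h6
    rw [h4]
    linear_combination -h1

section Partition

variable {ι : Type*} [DecidableEq ι]

/-- The number of members of `Γ` with `i` elements. -/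
def fcount (Γ : Finset (Finset ι)) (i : ℕ) : ℤ := ((Γ.filter fun G => G.card = i).card : ℤ)

/-- The number of members of the link of `u` in `Γ` with `i` elements. -/
def lcount (Γ : Finset (Finset ι)) (u : ι) (i : ℕ) : ℤ :=
  ((Γ.filter fun G => u ∈ G ∧ G.card = i + 1).card : ℤ)

lemma sum_lcount (Γ : Finset (Finset ι)) (V : Finset ι) (hV : ∀ G ∈ Γ, G ⊆ V) (i : ℕ) :
    ∑ u ∈ V, lcount Γ u i = ((i : ℤ) + 1) * fcount Γ (i + 1) := by
  have h := Finset.sum_card_bipartiteAbove_eq_sum_card_bipartiteBelow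
    (s := V) (t := Γ.filter fun G => G.card = i + 1) (fun u G => u ∈ G)
  have h2 : ∀ G ∈ Γ.filter (fun G => G.card = i + 1),
      (Finset.bipartiteBelow (fun u G => u ∈ G) V G).card = i + 1 := by
    intro G hG
    rw [Finset.mem_filter] at hG
    rw [← hG.2]
    congr 1
    ext u
    simp only [Finset.bipartiteBelow, Finset.mem_filter]
    exact ⟨fun h => h.2, fun h => ⟨hV G hG.1 h, h⟩⟩
  rw [Finset.sum_congr rfl h2, Finset.sum_const, smul_eq_mul] at h
  have h3 : ∀ u ∈ V, lcount Γ u i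
      = ((Finset.bipartiteAbove (fun u G => u ∈ G) (Γ.filter fun G => G.card = i + 1) u).card : ℤ)
      := by
    intro u _
    unfold lcount Finset.bipartiteAbove
    rw [Finset.filter_filter]
    simp only [and_comm]
  rw [Finset.sum_congr rfl h3, ← Nat.cast_sum, h, fcount]
  push_cast
  ring

lemma card_Icc_filter (A B : Finset ι) (hAB : A ⊆ B) (i : ℕ) :
    (((Finset.Icc A B).filter fun G => G.card = i).card : ℤ)
      = if A.card ≤ i then ((B.card - A.card).choose (i - A.card) : ℤ) else 0 := by
  split_ifs with h
  · have : (Finset.Icc A B).filter (fun G => G.card = i)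
        = ((B \ A).powersetCard (i - A.card)).image (A ∪ ·) := by
      ext G
      simp only [Finset.mem_filter, Finset.mem_Icc, Finset.mem_image, Finset.mem_powersetCard]
      constructor
      · rintro ⟨⟨h1, h2⟩, h3⟩
        refine ⟨G \ A, ⟨Finset.sdiff_subset_sdiff h2 subset_rfl, ?_⟩,
          Finset.union_sdiff_of_subset h1⟩
        rw [Finset.card_sdiff_of_subset h1, h3]
      · rintro ⟨S, ⟨h1, h2⟩, rfl⟩
        have hd : Disjoint A S := Finset.disjoint_left.2 fun x hx hS =>
          (Finset.mem_sdiff.1 (h1 hS)).2 hx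
        refine ⟨⟨Finset.subset_union_left,
          Finset.union_subset hAB (h1.trans Finset.sdiff_subset)⟩, ?_⟩
        rw [Finset.card_union_of_disjoint hd, h2]; omega
    rw [this, Finset.card_image_of_injOn, Finset.card_powersetCard,
      Finset.card_sdiff_of_subset hAB]
    intro S hS T hT hST
    rw [Finset.mem_coe, Finset.mem_powersetCard] at hS hT
    simp only [Finset.subset_iff, Finset.mem_sdiff] at hS hT
    ext x
    have := congrArg (x ∈ ·) hST
    simp only [Finset.mem_union, eq_iff_iff] at this
    constructor
    · intro hx
      exact (this.1 (Or.inr hx)).resolve_left (hS.1 hx).2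
    · intro hx
      exact (this.2 (Or.inr hx)).resolve_left (hT.1 hx).2
  · rw [Nat.cast_eq_zero, Finset.card_eq_zero, Finset.filter_eq_empty_iff]
    intro G hG hc
    rw [Finset.mem_Icc] at hG
    exact h (hc ▸ Finset.card_le_card hG.1)

/-- If `Γ` is partitioned into intervals `[R F, F]` over its members `F` of size `D + 1`, and `u`
belongs to no `R F` with `u ∈ F`, then the `h`-vector of the link of `u` is bounded by that
of `Γ`. -/
theorem hvec_lcount_le_of_partition {Γ : Finset (Finset ι)} {D : ℕ} {u : ι}
    (R : Finset ι → Finset ι)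
    (hsub : ∀ F ∈ Γ, F.card = D + 1 → R F ⊆ F)
    (hu : ∀ F ∈ Γ, F.card = D + 1 → u ∈ F → u ∉ R F)
    (hdown : ∀ F ∈ Γ, F.card = D + 1 → ∀ G, R F ⊆ G → G ⊆ F → G ∈ Γ)
    (hex : ∀ G ∈ Γ, ∃ F ∈ Γ, F.card = D + 1 ∧ R F ⊆ G ∧ G ⊆ F)
    (huniq : ∀ G F F', F ∈ Γ → F' ∈ Γ → F.card = D + 1 → F'.card = D + 1 →
      R F ⊆ G → G ⊆ F → R F' ⊆ G → G ⊆ F' → F = F') {k : ℕ} (hk : k ≤ D) :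
    hvec D (lcount Γ u) k ≤ hvec (D + 1) (fcount Γ) k := by
  classical
  set 𝓕 := Γ.filter fun F => F.card = D + 1 with h𝓕
  have hmem : ∀ F, F ∈ 𝓕 ↔ F ∈ Γ ∧ F.card = D + 1 := fun F => by rw [h𝓕, Finset.mem_filter]
  have hΓ : Γ = 𝓕.biUnion fun F => Finset.Icc (R F) F := by
    ext G
    simp only [Finset.mem_biUnion, Finset.mem_Icc, hmem]
    constructor
    · intro hG
      obtain ⟨F, h1, h2, h3, h4⟩ := hex G hG
      exact ⟨F, ⟨h1, h2⟩, h3, h4⟩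
    · rintro ⟨F, ⟨h1, h2⟩, h3, h4⟩
      exact hdown F h1 h2 G h3 h4
  have hcount : ∀ (p : Finset ι → Prop) [DecidablePred p], ((Γ.filter p).card : ℤ)
      = ∑ F ∈ 𝓕, (((Finset.Icc (R F) F).filter p).card : ℤ) := by
    intro p _
    rw [hΓ, Finset.filter_biUnion, Finset.card_biUnion, Nat.cast_sum]
    intro F hF F' hF' hne
    rw [Function.onFun, Finset.disjoint_left]
    intro G hG hG'
    simp only [Finset.mem_filter, Finset.mem_Icc] at hG hG'
    rw [Finset.mem_coe, hmem] at hF hF'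
    exact hne (huniq G F F' hF.1 hF'.1 hF.2 hF'.2 hG.1.1 hG.1.2 hG'.1.1 hG'.1.2)
  have h1 : hvec (D + 1) (fcount Γ) k = ∑ F ∈ 𝓕, if (R F).card = k then 1 else 0 := by
    have : fcount Γ = fun i => ∑ F ∈ 𝓕,
        if (R F).card ≤ i then ((D + 1 - (R F).card).choose (i - (R F).card) : ℤ) else 0 := by
      funext i
      rw [fcount, hcount]
      refine Finset.sum_congr rfl fun F hF => ?_
      rw [hmem] at hF
      rw [card_Icc_filter _ _ (hsub F hF.1 hF.2), hF.2]
    rw [this, hvec_sum]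
    refine Finset.sum_congr rfl fun F hF => ?_
    rw [hmem] at hF
    exact hvec_interval (by omega)
  have h2 : hvec D (lcount Γ u) k
      = ∑ F ∈ 𝓕, if u ∈ F then (if (R F).card = k then 1 else 0) else 0 := by
    have : lcount Γ u = fun i => ∑ F ∈ 𝓕, if u ∈ F then
        (if (R F).card ≤ i then ((D - (R F).card).choose (i - (R F).card) : ℤ) else 0) else 0 := by
      funext i
      rw [lcount, hcount]
      refine Finset.sum_congr rfl fun F hF => ?_
      rw [hmem] at hF
      split_ifs with huF hle
      · have := card_Icc_filter (insert u (R F)) F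
          (Finset.insert_subset huF (hsub F hF.1 hF.2)) (i + 1)
        rw [Finset.card_insert_of_notMem (hu F hF.1 hF.2 huF), hF.2, if_pos (by omega),
          show D + 1 - ((R F).card + 1) = D - (R F).card by omega,
          show i + 1 - ((R F).card + 1) = i - (R F).card by omega] at this
        rw [← this]
        congr 2
        ext G
        simp only [Finset.mem_filter, Finset.mem_Icc, Finset.insert_subset_iff]
        tauto
      · have := card_Icc_filter (insert u (R F)) F
          (Finset.insert_subset huF (hsub F hF.1 hF.2)) (i + 1)
        rw [Finset.card_insert_of_notMem (hu F hF.1 hF.2 huF), if_neg (by omega)] at this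
        rw [← this]
        congr 2
        ext G
        simp only [Finset.mem_filter, Finset.mem_Icc, Finset.insert_subset_iff]
        tauto
      · rw [Nat.cast_eq_zero, Finset.card_eq_zero, Finset.filter_eq_empty_iff]
        intro G hG h
        rw [Finset.mem_Icc] at hG
        exact huF (hG.2 h.1)
    rw [this, hvec_sum]
    refine Finset.sum_congr rfl fun F hF => ?_
    rw [hmem] at hF
    split_ifs with huF hc
    · rw [hvec_interval hk, if_pos hc]
    · rw [hvec_interval hk, if_neg hc]
    · simp [hvec]
  rw [h1, h2]
  refine Finset.sum_le_sum fun F _ => ?_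
  split_ifs <;> simp

end Partition

section Sweep

variable {ι W : Type*} [AddCommGroup W] [Module ℝ W]

open Classical in
/-- The indices in `V` of the vectors annihilated by the functional `φ`. -/
def zeroSet (V : Finset ι) (x : ι → W) (φ : Module.Dual ℝ W) : Finset ι :=
  V.filter fun i => φ (x i) = 0

lemma mem_zeroSet {V : Finset ι} {x : ι → W} {φ : Module.Dual ℝ W} {i : ι} :
    i ∈ zeroSet V x φ ↔ i ∈ V ∧ φ (x i) = 0 := by
  classical
  simp [zeroSet]

lemma zeroSet_subset (V : Finset ι) (x : ι → W) (φ : Module.Dual ℝ W) : zeroSet V x φ ⊆ V :=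
  fun _ hi => (mem_zeroSet.1 hi).1

/-- Moving a nonnegative functional `φ` in the direction `ψ` until a new constraint is tight. -/
lemma exists_move {V : Finset ι} {x : ι → W} {φ ψ : Module.Dual ℝ W}
    (hφ : ∀ i ∈ V, 0 ≤ φ (x i)) (hψ : ∀ i ∈ V, φ (x i) = 0 → 0 ≤ ψ (x i))
    (hneg : ∃ i ∈ V, ψ (x i) < 0) :
    ∃ τ : ℝ, 0 < τ ∧ (∀ i ∈ V, 0 ≤ (φ + τ • ψ) (x i)) ∧
      ∃ i ∈ V, φ (x i) ≠ 0 ∧ (φ + τ • ψ) (x i) = 0 := by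
  classical
  obtain ⟨i0, hi0, hi0'⟩ := hneg
  obtain ⟨i, hi, hmin⟩ := Finset.exists_min_image (V.filter fun i => ψ (x i) < 0)
    (fun i => φ (x i) / (-ψ (x i))) ⟨i0, Finset.mem_filter.2 ⟨hi0, hi0'⟩⟩
  rw [Finset.mem_filter] at hi
  have hne : φ (x i) ≠ 0 := fun h => absurd (hψ i hi.1 h) (not_le.2 hi.2)
  have hpos : 0 < φ (x i) := lt_of_le_of_ne (hφ i hi.1) (Ne.symm hne)
  refine ⟨φ (x i) / (-ψ (x i)), div_pos hpos (by linarith [hi.2]), ?_, i, hi.1, hne, ?_⟩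
  · intro j hj
    simp only [LinearMap.add_apply, LinearMap.smul_apply, smul_eq_mul]
    have hτ : 0 < φ (x i) / (-ψ (x i)) := div_pos hpos (by linarith [hi.2])
    rcases lt_or_ge (ψ (x j)) 0 with h | h
    · have := hmin j (Finset.mem_filter.2 ⟨hj, h⟩)
      rw [le_div_iff₀ (by linarith)] at this
      linarith
    · have := hφ j hj
      positivity
  · simp only [LinearMap.add_apply, LinearMap.smul_apply, smul_eq_mul]
    have := hi.2.ne
    field_simp
    ring

/-- Near a given vector there are generic positive combinations. -/
lemma exists_generic_weights {J : Finset ι} {x : ι → W} {u : ι} (hu : u ∈ J)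
    (Ψ : Finset (Module.Dual ℝ W)) (hΨ : ∀ ψ ∈ Ψ, ∃ j ∈ J, ψ (x j) ≠ 0) :
    ∃ w : ι → ℝ, (∀ j ∈ J, 0 < w j) ∧ ∀ ψ ∈ Ψ, ψ (∑ j ∈ J, w j • x j) ≠ 0 ∧
      (0 < ψ (x u) → 0 < ψ (∑ j ∈ J, w j • x j)) := by
  classical
  obtain ⟨e, he⟩ : ∃ e : ι → ℕ, Set.InjOn e J := by
    refine ⟨fun i => if h : i ∈ J then (J.equivFin ⟨i, h⟩ : ℕ) else 0, ?_⟩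
    intro a ha b hb hab
    simp only [Finset.mem_coe] at ha hb
    simp only [dif_pos ha, dif_pos hb] at hab
    have := J.equivFin.injective (Fin.ext hab)
    simpa using this
  let p : Module.Dual ℝ W → Polynomial ℝ := fun ψ =>
    ∑ j ∈ J, Polynomial.monomial (e j) (ψ (x j))
  have hp : ∀ ψ ∈ Ψ, p ψ ≠ 0 := by
    intro ψ hψ h0
    obtain ⟨j, hj, hj'⟩ := hΨ ψ hψ
    apply hj'
    have := congrArg (fun q => Polynomial.coeff q (e j)) h0
    simp only [p, Polynomial.finsetSum_coeff, Polynomial.coeff_monomial,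
      Polynomial.coeff_zero] at this
    rw [Finset.sum_eq_single j] at this
    · simpa using this
    · intro b hb hbj
      rw [if_neg]
      exact fun h => hbj (he hb hj h)
    · exact fun h => absurd hj h
  obtain ⟨t, ht, htr⟩ : ∃ t : ℝ, 0 < t ∧ ∀ ψ ∈ Ψ, (p ψ).eval t ≠ 0 := by
    have hfin : (↑(Ψ.biUnion fun ψ => (p ψ).roots.toFinset) : Set ℝ).Finite :=
      Finset.finite_toSet _
    obtain ⟨t, ht, ht'⟩ := (Set.Ioi_infinite (0 : ℝ)).exists_notMem_finite hfin
    refine ⟨t, ht, fun ψ hψ h0 => ht' ?_⟩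
    simp only [Finset.mem_coe, Finset.mem_biUnion, Multiset.mem_toFinset]
    exact ⟨ψ, hψ, (Polynomial.mem_roots (hp ψ hψ)).2 h0⟩
  set c' : W := ∑ j ∈ J, t ^ e j • x j with hc'
  have eval_p : ∀ ψ : Module.Dual ℝ W, ψ c' = (p ψ).eval t := by
    intro ψ
    simp only [hc', p, map_sum, map_smul, smul_eq_mul, Polynomial.eval_finsetSum,
      Polynomial.eval_monomial]
    exact Finset.sum_congr rfl fun _ _ => mul_comm _ _
  have hev : ∀ᶠ ε in nhdsWithin (0 : ℝ) (Set.Ioi 0), ∀ ψ ∈ Ψ,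
      ψ (x u) + ε * ψ c' ≠ 0 ∧ (0 < ψ (x u) → 0 < ψ (x u) + ε * ψ c') := by
    rw [Filter.eventually_all_finset]
    intro ψ hψ
    have hcont : Filter.Tendsto (fun ε : ℝ => ψ (x u) + ε * ψ c') (nhdsWithin 0 (Set.Ioi 0))
        (nhds (ψ (x u))) := by
      have : Continuous fun ε : ℝ => ψ (x u) + ε * ψ c' := by fun_prop
      have h := this.tendsto 0
      simp only [zero_mul, add_zero] at h
      exact h.mono_left nhdsWithin_le_nhds
    rcases lt_trichotomy (ψ (x u)) 0 with h | h | h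
    · filter_upwards [hcont.eventually_lt_const h] with ε hε
      exact ⟨hε.ne, fun h' => absurd h (not_lt.2 h'.le)⟩
    · filter_upwards [self_mem_nhdsWithin] with ε hε
      rw [h, zero_add]
      refine ⟨mul_ne_zero (ne_of_gt hε) ?_, fun h' => absurd h' (lt_irrefl _)⟩
      rw [eval_p]
      exact htr ψ hψ
    · filter_upwards [hcont.eventually_const_lt h] with ε hε
      exact ⟨hε.ne', fun _ => hε⟩
  obtain ⟨ε, hε, hε0⟩ := (hev.and self_mem_nhdsWithin).exists
  have hε0 : 0 < ε := hε0
  refine ⟨fun j => (if j = u then 1 else 0) + ε * t ^ e j, ?_, ?_⟩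
  · intro j _
    have : 0 < ε * t ^ e j := by positivity
    dsimp only
    split_ifs <;> linarith
  · have hc : ∑ j ∈ J, ((if j = u then (1 : ℝ) else 0) + ε * t ^ e j) • x j = x u + ε • c' := by
      simp only [add_smul, Finset.sum_add_distrib, hc', Finset.smul_sum, mul_smul, ite_smul,
        one_smul, zero_smul, Finset.sum_ite_eq', hu, if_true]
    intro ψ hψ
    rw [hc, map_add, map_smul, smul_eq_mul]
    exact hε ψ hψ

/-- The dual basis associated with a facet `F` and a functional `φ` supporting it. -/
lemma exists_dual_coordinates [DecidableEq ι] [FiniteDimensional ℝ W] {x : ι → W} {F : Finset ι} {O : W}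
    {φ : Module.Dual ℝ W} (hind : LinearIndepOn ℝ x (F : Set ι)) (hφ : ∀ i ∈ F, φ (x i) = 0)
    (hO : φ O = 1) (hcard : F.card + 1 = Module.finrank ℝ W) :
    ∃ A : ι → Module.Dual ℝ W, (∀ i ∈ F, ∀ j ∈ F, A i (x j) = if i = j then 1 else 0) ∧
      (∀ i ∈ F, A i O = 0) ∧ ∀ w, w = ∑ i ∈ F, A i w • x i + φ w • O := by
  classical
  let v : Option F → W := fun o => Option.casesOn' o O fun i => x i
  have hv : LinearIndependent ℝ v := by
    rw [linearIndependent_option']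
    refine ⟨hind, fun h => ?_⟩
    have : Submodule.span ℝ (Set.range fun i : F => x i) ≤ LinearMap.ker φ := by
      rw [Submodule.span_le]
      rintro _ ⟨i, rfl⟩
      exact hφ i i.2
    have h0 : φ O = 0 := this h
    rw [hO] at h0
    exact one_ne_zero h0
  have hc : Fintype.card (Option F) = Module.finrank ℝ W := by
    rw [Fintype.card_option, Fintype.card_coe, hcard]
  let b := basisOfLinearIndependentOfCardEqFinrank hv hc
  have hb : ∀ o, b o = v o := fun o => by
    simp [b, coe_basisOfLinearIndependentOfCardEqFinrank]
  refine ⟨fun i => if h : i ∈ F then b.coord (some ⟨i, h⟩) else 0, ?_, ?_, ?_⟩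
  · intro i hi j hj
    have h1 : x j = b (some ⟨j, hj⟩) := by rw [hb]; rfl
    simp only [dif_pos hi]
    rw [h1, Module.Basis.coord_apply, Module.Basis.repr_self, Finsupp.single_apply]
    simp [eq_comm]
  · intro i hi
    have h1 : O = b none := by rw [hb]; rfl
    simp only [dif_pos hi]
    rw [h1, Module.Basis.coord_apply, Module.Basis.repr_self, Finsupp.single_apply]
    simp
  · intro w
    have h1 := b.sum_repr w
    rw [Fintype.sum_option, hb] at h1
    have h2 : φ w = b.repr w none := by
      conv_lhs => rw [← h1]
      simp only [map_add, map_sum, map_smul, hb]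
      simp [v, hO, hφ]
    rw [h2]
    conv_lhs => rw [← h1]
    rw [add_comm]
    congr 1
    rw [← Finset.sum_coe_sort F]
    refine Finset.sum_congr rfl fun i _ => ?_
    rw [hb]
    simp [v]

/-- The main sweep argument. `Γ` is a family of index sets of faces of the cone spanned by the
vectors `x i`, `i ∈ V`, avoiding the vector `O`. Sweeping with a generic positive combination of the
`x j`, `j ∈ J`, close to `x u`, bounds the `h`-vector of the link of `u`. -/
theorem hvec_lcount_le [DecidableEq ι] [FiniteDimensional ℝ W] {V J : Finset ι} {x : ι → W} {O : W} {D : ℕ}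
    (hW : Module.finrank ℝ W = D + 2) (Γ : Finset (Finset ι)) (hJ : J ⊆ V)
    (hface : ∀ G ∈ Γ, ∃ φ : Module.Dual ℝ W, (∀ i ∈ V, 0 ≤ φ (x i)) ∧ φ O = 1 ∧
      zeroSet V x φ = G)
    (hup : ∀ G ∈ Γ, ∀ φ : Module.Dual ℝ W, (∀ i ∈ V, 0 ≤ φ (x i)) → φ O = 1 →
      G ⊆ zeroSet V x φ → zeroSet V x φ ∈ Γ)
    (hind : ∀ G ∈ Γ, LinearIndepOn ℝ x (G : Set ι))
    (hspan : ∀ ψ : Module.Dual ℝ W, ψ O = 0 → (∀ j ∈ J, ψ (x j) = 0) → ψ = 0)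
    (hdown : ∀ F ∈ Γ, ∀ G ⊆ F, ∀ (w a : ι → ℝ) (b : ℝ), (∀ j ∈ J, 0 < w j) → 0 ≤ b →
      ∑ j ∈ J, w j • x j = ∑ i ∈ F, a i • x i + b • O → (∀ i ∈ F, i ∉ G → 0 ≤ a i) → G ∈ Γ)
    {u : ι} (hu : u ∈ J) {k : ℕ} (hk : k ≤ D) :
    hvec D (lcount Γ u) k ≤ hvec (D + 1) (fcount Γ) k := by
  classical
  have hdata : ∀ F, ∃ (φ : Module.Dual ℝ W) (A : ι → Module.Dual ℝ W),
      F ∈ Γ → F.card = D + 1 → (∀ i ∈ V, 0 ≤ φ (x i)) ∧ φ O = 1 ∧ zeroSet V x φ = F ∧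
        (∀ i ∈ F, ∀ j ∈ F, A i (x j) = if i = j then 1 else 0) ∧
        (∀ i ∈ F, A i O = 0) ∧ ∀ w, w = ∑ i ∈ F, A i w • x i + φ w • O := by
    intro F
    by_cases h : F ∈ Γ ∧ F.card = D + 1
    · obtain ⟨φ, h1, h2, h3⟩ := hface F h.1
      obtain ⟨A, hA1, hA2, hA3⟩ := exists_dual_coordinates (hind F h.1)
        (fun i hi => (mem_zeroSet.1 (h3 ▸ hi)).2) h2 (by rw [h.2, hW])
      exact ⟨φ, A, fun _ _ => ⟨h1, h2, h3, hA1, hA2, hA3⟩⟩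
    · exact ⟨0, 0, fun h1 h2 => absurd ⟨h1, h2⟩ h⟩
  choose φ A hdata using hdata
  have hsubV : ∀ F ∈ Γ, F ⊆ V := by
    intro F hF
    obtain ⟨φ, _, _, h⟩ := hface F hF
    exact h ▸ zeroSet_subset _ _ _
  obtain ⟨w, hw, hgen⟩ := exists_generic_weights (x := x) hu
    ((Γ.filter fun F => F.card = D + 1).biUnion fun F => F.image (A F)) (by
      intro ψ hψ
      simp only [Finset.mem_biUnion, Finset.mem_filter, Finset.mem_image] at hψ
      obtain ⟨F, ⟨hF, hFc⟩, i, hi, rfl⟩ := hψ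
      obtain ⟨_, _, _, h4, h5, _⟩ := hdata F hF hFc
      by_contra! hcon
      have := hspan _ (h5 i hi) hcon
      have h1 := h4 i hi i hi
      rw [this] at h1
      simp at h1)
  set c : W := ∑ j ∈ J, w j • x j with hc
  have hgen' : ∀ F ∈ Γ, F.card = D + 1 → ∀ i ∈ F, A F i c ≠ 0 ∧ (0 < A F i (x u) → 0 < A F i c) := by
    intro F hF hFc i hi
    apply hgen
    simp only [Finset.mem_biUnion, Finset.mem_filter, Finset.mem_image]
    exact ⟨F, ⟨hF, hFc⟩, i, hi, rfl⟩
  have hcpos : ∀ ψ : Module.Dual ℝ W, (∀ i ∈ V, 0 ≤ ψ (x i)) → 0 ≤ ψ c := by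
    intro ψ hψ
    rw [hc, map_sum]
    refine Finset.sum_nonneg fun j hj => ?_
    rw [map_smul, smul_eq_mul]
    exact mul_nonneg (hw j hj).le (hψ j (hJ hj))
  have hczero : ∀ ψ : Module.Dual ℝ W, (∀ i ∈ V, 0 ≤ ψ (x i)) → ψ c ≤ 0 → ψ O = 0 → ψ = 0 := by
    intro ψ hψ hle hO
    refine hspan ψ hO fun j hj => ?_
    have h0 : ψ c = 0 := le_antisymm hle (hcpos ψ hψ)
    rw [hc, map_sum, Finset.sum_eq_zero_iff_of_nonneg] at h0
    · have := h0 j hj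
      rw [map_smul, smul_eq_mul] at this
      exact (mul_eq_zero.1 this).resolve_left (hw j hj).ne'
    · intro j hj
      rw [map_smul, smul_eq_mul]
      exact mul_nonneg (hw j hj).le (hψ j (hJ hj))
  have hcard : ∀ G ∈ Γ, G.card ≤ D + 1 := by
    intro G hG
    obtain ⟨φ, _, h2, h3⟩ := hface G hG
    have hi := hind G hG
    have hlt : Submodule.span ℝ (x '' G) < ⊤ := by
      rw [lt_top_iff_ne_top]
      intro htop
      have hle : Submodule.span ℝ (x '' G) ≤ LinearMap.ker φ := by
        rw [Submodule.span_le]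
        rintro _ ⟨i, hi, rfl⟩
        exact (mem_zeroSet.1 (h3 ▸ hi)).2
      rw [htop] at hle
      have h0 : φ O = 0 := hle (Submodule.mem_top)
      rw [h2] at h0
      exact one_ne_zero h0
    have h1 := Submodule.finrank_lt hlt.ne
    have h4 : Module.finrank ℝ (Submodule.span ℝ (Set.range fun i : G => x i))
        = Fintype.card G := finrank_span_eq_card hi
    have h5 : Set.range (fun i : G => x i) = x '' G := by
      ext y; simp
    rw [h5, Fintype.card_coe] at h4
    omega
  -- every member extends to one of maximal size
  have hfacet : ∀ G ∈ Γ, ∃ F ∈ Γ, F.card = D + 1 ∧ G ⊆ F := by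
    intro G hG
    obtain ⟨F, hF, hmax⟩ := Finset.exists_max_image (Γ.filter fun F => G ⊆ F) Finset.card
      ⟨G, Finset.mem_filter.2 ⟨hG, subset_rfl⟩⟩
    rw [Finset.mem_filter] at hF
    refine ⟨F, hF.1, ?_, hF.2⟩
    by_contra hne
    have hlt : F.card < D + 1 := lt_of_le_of_ne (hcard F hF.1) hne
    obtain ⟨φ, h1, h2, h3⟩ := hface F hF.1
    obtain ⟨ψ, hψ0, hψF, hψO⟩ : ∃ ψ : Module.Dual ℝ W, ψ ≠ 0 ∧ (∀ i ∈ F, ψ (x i) = 0) ∧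
        ψ O = 0 := by
      let S : Finset W := insert O (F.image x)
      have hS : S.card < Module.finrank ℝ W := by
        have h1 : S.card ≤ (F.image x).card + 1 := Finset.card_insert_le O (F.image x)
        have := Finset.card_image_le (s := F) (f := x)
        omega
      have hlt : Submodule.span ℝ (S : Set W) < ⊤ := by
        rw [lt_top_iff_ne_top]
        intro htop
        have := finrank_span_finset_le_card (R := ℝ) S
        rw [Set.finrank, htop, finrank_top] at this
        omega
      obtain ⟨ψ, hψ, hle⟩ := Submodule.exists_le_ker_of_lt_top _ hlt
      refine ⟨ψ, hψ, fun i hi => ?_, ?_⟩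
      · exact hle (Submodule.subset_span (by simp [S]; right; exact ⟨i, hi, rfl⟩))
      · exact hle (Submodule.subset_span (by simp [S]))
    wlog hle : ψ c ≤ 0 generalizing ψ
    · exact this (-ψ) (neg_ne_zero.2 hψ0) (fun i hi => by simp [hψF i hi]) (by simp [hψO])
        (by simp; linarith)
    have hneg : ∃ i ∈ V, ψ (x i) < 0 := by
      by_contra! hcon
      exact hψ0 (hczero ψ hcon hle hψO)
    obtain ⟨τ, _, hτ, i, hiV, hi1, hi2⟩ := exists_move h1
      (fun i hi h0 => (hψF i (h3 ▸ mem_zeroSet.2 ⟨hi, h0⟩)).ge) hneg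
    have hsub : insert i F ⊆ zeroSet V x (φ + τ • ψ) := by
      rw [Finset.insert_subset_iff]
      refine ⟨mem_zeroSet.2 ⟨hiV, hi2⟩, fun j hj => mem_zeroSet.2 ⟨hsubV F hF.1 hj, ?_⟩⟩
      have : φ (x j) = 0 := (mem_zeroSet.1 (h3 ▸ hj)).2
      simp [this, hψF j hj]
    have hmem := hup F hF.1 (φ + τ • ψ) hτ (by simp [h2, hψO])
      ((Finset.subset_insert _ _).trans hsub)
    have hle := hmax _ (Finset.mem_filter.2
      ⟨hmem, hF.2.trans ((Finset.subset_insert _ _).trans hsub)⟩)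
    have hiF : i ∉ F := fun h => hi1 (mem_zeroSet.1 (h3 ▸ h)).2
    have := Finset.card_le_card hsub
    rw [Finset.card_insert_of_notMem hiF] at this
    omega
  clear_value c
  have hφc : ∀ F ∈ Γ, F.card = D + 1 → 0 ≤ φ F c := fun F hF hFc =>
    hcpos _ (hdata F hF hFc).1
  refine hvec_lcount_le_of_partition (fun F => F.filter fun i => A F i c < 0)
    (fun F _ _ => Finset.filter_subset _ _) ?_ ?_ ?_ ?_ hk
  · intro F hF hFc huF hcon
    rw [Finset.mem_filter] at hcon
    have h1 := (hgen' F hF hFc u huF).2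
    rw [(hdata F hF hFc).2.2.2.1 u huF u huF, if_pos rfl] at h1
    linarith [h1 one_pos, hcon.2]
  · intro F hF hFc G hRG hGF
    refine hdown F hF G hGF w (fun i => A F i c) (φ F c) hw (hφc F hF hFc)
      (hc ▸ (hdata F hF hFc).2.2.2.2.2 c) fun i hi hiG => ?_
    by_contra! hcon
    exact hiG (hRG (Finset.mem_filter.2 ⟨hi, hcon⟩))
  · intro G hG
    obtain ⟨F0, hF0, hF0c, hGF0⟩ := hfacet G hG
    obtain ⟨F, hF, hmin⟩ := Finset.exists_min_image
      (Γ.filter fun F => F.card = D + 1 ∧ G ⊆ F) (fun F => φ F c)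
      ⟨F0, Finset.mem_filter.2 ⟨hF0, hF0c, hGF0⟩⟩
    rw [Finset.mem_filter] at hF
    obtain ⟨hFΓ, hFc, hGF⟩ := hF
    refine ⟨F, hFΓ, hFc, ?_, hGF⟩
    intro i hi
    rw [Finset.mem_filter] at hi
    by_contra hiG
    obtain ⟨h1, h2, h3, h4, h5, h6⟩ := hdata F hFΓ hFc
    have hneg : ∃ j ∈ V, A F i (x j) < 0 := by
      by_contra! hcon
      linarith [hcpos _ hcon, hi.2]
    obtain ⟨τ, hτ0, hτ, j, hjV, hj1, hj2⟩ := exists_move h1 (ψ := A F i) (by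
      intro j hj h0
      have hjF : j ∈ F := h3 ▸ mem_zeroSet.2 ⟨hj, h0⟩
      rw [h4 i hi.1 j hjF]
      split_ifs <;> norm_num) hneg
    have hjF : j ∉ F := fun h => hj1 (mem_zeroSet.1 (h3 ▸ h)).2
    set F' := zeroSet V x (φ F + τ • A F i) with hF'
    have hsub : insert j (F.erase i) ⊆ F' := by
      rw [Finset.insert_subset_iff]
      refine ⟨mem_zeroSet.2 ⟨hjV, hj2⟩, fun l hl => ?_⟩
      rw [Finset.mem_erase] at hl
      have hl0 : φ F (x l) = 0 := (mem_zeroSet.1 (h3.symm ▸ hl.2)).2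
      refine mem_zeroSet.2 ⟨hsubV F hFΓ hl.2, ?_⟩
      simp [hl0, h4 i hi.1 l hl.2, hl.1.symm]
    have hGF' : G ⊆ F' := fun l hl => hsub (Finset.mem_insert_of_mem
      (Finset.mem_erase.2 ⟨fun h => hiG (h ▸ hl), hGF hl⟩))
    have hO' : (φ F + τ • A F i) O = 1 := by simp [h2, h5 i hi.1]
    have hF'Γ : F' ∈ Γ := hup G hG _ hτ hO' hGF'
    have hF'c : F'.card = D + 1 := by
      refine le_antisymm (hcard _ hF'Γ) ?_
      have := Finset.card_le_card hsub
      rw [Finset.card_insert_of_notMem (fun h => hjF (Finset.mem_of_mem_erase h)),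
        Finset.card_erase_of_mem hi.1, hFc] at this
      omega
    have hle := hmin F' (Finset.mem_filter.2 ⟨hF'Γ, hF'c, hGF'⟩)
    -- the supporting functional of a facet is unique
    have heq : φ F' c = (φ F + τ • A F i) c := by
      obtain ⟨_, _, _, _, _, g6⟩ := hdata F' hF'Γ hF'c
      have h := congrArg (φ F + τ • A F i) (g6 c)
      rw [map_add, map_sum, map_smul, hO', Finset.sum_eq_zero] at h
      · simpa using h.symm
      · intro l hl
        rw [map_smul, (mem_zeroSet.1 hl).2, smul_zero]
    rw [heq] at hle
    simp only [LinearMap.add_apply, LinearMap.smul_apply, smul_eq_mul] at hle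
    have := mul_neg_of_pos_of_neg hτ0 hi.2
    linarith
  · have key : ∀ G F F', F ∈ Γ → F' ∈ Γ → F.card = D + 1 → F'.card = D + 1 →
        (F.filter fun i => A F i c < 0) ⊆ G → G ⊆ F' →
        φ F c ≤ φ F' c ∧ (φ F' c ≤ φ F c → F ⊆ F') := by
      intro G F F' hF hF' hFc hF'c hR hGF'
      obtain ⟨_, _, _, _, _, h6⟩ := hdata F hF hFc
      obtain ⟨g1, g2, g3, _, _, _⟩ := hdata F' hF' hF'c
      have h := congrArg (φ F') (h6 c)
      rw [map_add, map_sum, map_smul, g2, smul_eq_mul, mul_one] at h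
      have hnn : ∀ i ∈ F, 0 ≤ φ F' (A F i c • x i) := by
        intro i hi
        rw [map_smul, smul_eq_mul]
        by_cases hneg : A F i c < 0
        · have := (mem_zeroSet.1 (g3.symm ▸ hGF' (hR (Finset.mem_filter.2 ⟨hi, hneg⟩)))).2
          rw [this, mul_zero]
        · exact mul_nonneg (not_lt.1 hneg) (g1 i (hsubV F hF hi))
      refine ⟨by linarith [Finset.sum_nonneg hnn], fun hle i hi => ?_⟩
      have h0 : ∑ i ∈ F, φ F' (A F i c • x i) = 0 :=
        le_antisymm (by linarith) (Finset.sum_nonneg hnn)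
      rw [Finset.sum_eq_zero_iff_of_nonneg hnn] at h0
      have := h0 i hi
      rw [map_smul, smul_eq_mul] at this
      have := (mul_eq_zero.1 this).resolve_left (hgen' F hF hFc i hi).1
      rw [← g3]
      exact mem_zeroSet.2 ⟨hsubV F hF hi, this⟩
    intro G F F' hF hF' hFc hF'c hR hGF hR' hGF'
    have h1 := key G F F' hF hF' hFc hF'c hR hGF'
    have h2 := key G F' F hF' hF hF'c hFc hR' hGF
    exact Finset.eq_of_subset_of_card_le (h1.2 h2.1) (by omega)

end Sweep

lemma hvec_shift {D k : ℕ} {f : ℕ → ℤ} (h0 : f 0 = 0) :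
    hvec (D + 1) f (k + 1) = hvec D (fun i => f (i + 1)) k := by
  unfold hvec
  rw [Finset.sum_range_succ', h0, mul_zero, add_zero]
  refine Finset.sum_congr rfl fun i _ => ?_
  simp only [Nat.add_sub_add_right]

lemma fcount_zero_le {ι : Type*} (Γ : Finset (Finset ι)) : fcount Γ 0 ≤ 1 := by
  classical
  have h : (Γ.filter fun G => G.card = 0) ⊆ {∅} := fun G hG => by
    simpa using (Finset.mem_filter.1 hG).2
  have := Finset.card_le_card h
  rw [Finset.card_singleton] at this
  unfold fcount
  exact_mod_cast this

lemma succ_mul_ubTerm {n d k : ℕ} (hn : d + 1 ≤ n) :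
    ((k : ℤ) + 1) * ubTerm n d (k + 1) = ((n : ℤ) - d - 1 + k) * ubTerm n d k := by
  unfold ubTerm
  obtain ⟨m, rfl⟩ : ∃ m, n = d + 1 + m := ⟨n - (d + 1), by omega⟩
  rcases Nat.eq_zero_or_pos (m + k) with h | h
  · obtain ⟨rfl, rfl⟩ : m = 0 ∧ k = 0 := by omega
    simp
  · obtain ⟨r, hr⟩ : ∃ r, m + k = r + 1 := ⟨m + k - 1, by omega⟩
    have h1 : d + 1 + m + (k + 1) - (d + 2) = r + 1 := by omega
    have h2 : d + 1 + m + k - (d + 2) = r := by omega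
    rw [h1, h2]
    have h3 := Nat.add_one_mul_choose_eq r k
    zify at h3 hr
    have h4 : (((d + 1 + m : ℕ) : ℤ) - d - 1 + k) = r + 1 := by push_cast; linarith
    rw [h4, h3]
    ring

lemma ubTerm_zero (n d : ℕ) : ubTerm n d 0 = 1 := by simp [ubTerm]

section Faces

variable {ι W : Type*} [AddCommGroup W] [Module ℝ W]

open Classical in
/-- The zero sets of the functionals nonnegative on the vectors `x i`, `i ∈ V`, and positive
at `O`. -/
def facesOff (V : Finset ι) (x : ι → W) (O : W) : Finset (Finset ι) :=
  V.powerset.filter fun G => ∃ φ : Module.Dual ℝ W, (∀ i ∈ V, 0 ≤ φ (x i)) ∧ 0 < φ O ∧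
    zeroSet V x φ = G

lemma mem_facesOff {V : Finset ι} {x : ι → W} {O : W} {G : Finset ι} :
    G ∈ facesOff V x O ↔ ∃ φ : Module.Dual ℝ W, (∀ i ∈ V, 0 ≤ φ (x i)) ∧ 0 < φ O ∧
      zeroSet V x φ = G := by
  classical
  simp only [facesOff, Finset.mem_filter, Finset.mem_powerset, and_iff_right_iff_imp]
  rintro ⟨φ, _, _, rfl⟩
  exact zeroSet_subset _ _ _

lemma subset_of_mem_facesOff {V : Finset ι} {x : ι → W} {O : W} {G : Finset ι}
    (h : G ∈ facesOff V x O) : G ⊆ V := by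
  obtain ⟨φ, _, _, rfl⟩ := mem_facesOff.1 h
  exact zeroSet_subset _ _ _

lemma exists_normalized_of_mem_facesOff {V : Finset ι} {x : ι → W} {O : W} {G : Finset ι}
    (h : G ∈ facesOff V x O) : ∃ φ : Module.Dual ℝ W, (∀ i ∈ V, 0 ≤ φ (x i)) ∧ φ O = 1 ∧
      zeroSet V x φ = G := by
  obtain ⟨φ, h1, h2, rfl⟩ := mem_facesOff.1 h
  refine ⟨(φ O)⁻¹ • φ, fun i hi => ?_, ?_, ?_⟩
  · rw [LinearMap.smul_apply, smul_eq_mul]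
    exact mul_nonneg (inv_nonneg.2 h2.le) (h1 i hi)
  · rw [LinearMap.smul_apply, smul_eq_mul, inv_mul_cancel₀ h2.ne']
  · ext i
    simp [mem_zeroSet, h2.ne']

/-- A functional prescribed on a linearly independent family. -/
lemma exists_dual_eq {x : ι → W} {F : Finset ι} (hind : LinearIndepOn ℝ x (F : Set ι))
    (c : ι → ℝ) : ∃ ψ : Module.Dual ℝ W, ∀ i ∈ F, ψ (x i) = c i := by
  have hind' : LinearIndependent ℝ fun i : F => x i := hind
  obtain ⟨ψ, hψ⟩ := LinearMap.exists_extend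
    ((Module.Basis.span hind').constr ℝ (fun i : F => c i))
  refine ⟨ψ, fun i hi => ?_⟩
  have h := LinearMap.congr_fun hψ (Module.Basis.span hind' ⟨i, hi⟩)
  rw [Module.Basis.constr_basis] at h
  simpa [Module.Basis.span_apply] using h

/-- Subsets of simplicial faces are faces. -/
lemma mem_facesOff_of_subset {V : Finset ι} {x : ι → W} {O : W} {F G : Finset ι}
    (hF : F ∈ facesOff V x O) (hind : LinearIndepOn ℝ x (F : Set ι)) (hG : G ⊆ F) :
    G ∈ facesOff V x O := by
  classical
  obtain ⟨φ, h1, h2, h3⟩ := mem_facesOff.1 hF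
  obtain ⟨ψ, hψ⟩ := exists_dual_eq hind (fun i => if i ∈ G then 0 else 1)
  have hcont : ∀ w, Filter.Tendsto (fun ε : ℝ => φ w + ε * ψ w) (nhdsWithin 0 (Set.Ioi 0))
      (nhds (φ w)) := by
    intro w
    have : Continuous fun ε : ℝ => φ w + ε * ψ w := by fun_prop
    have h := this.tendsto 0
    simp only [zero_mul, add_zero] at h
    exact h.mono_left nhdsWithin_le_nhds
  have hev : ∀ᶠ ε in nhdsWithin (0 : ℝ) (Set.Ioi 0), ∀ i ∈ V, φ (x i) ≠ 0 →
      0 < φ (x i) + ε * ψ (x i) := by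
    rw [Filter.eventually_all_finset]
    intro i hi
    by_cases h : φ (x i) = 0
    · exact Filter.Eventually.of_forall fun _ h' => absurd h h'
    · filter_upwards [(hcont (x i)).eventually_const_lt (lt_of_le_of_ne (h1 i hi) (Ne.symm h))]
        with ε hε _ using hε
  obtain ⟨ε, ⟨hε1, hε2⟩, hε0⟩ :=
    ((hev.and ((hcont O).eventually_const_lt h2)).and self_mem_nhdsWithin).exists
  have hε0 : 0 < ε := hε0
  have hval : ∀ i ∈ F, φ (x i) = 0 := fun i hi => (mem_zeroSet.1 (h3 ▸ hi)).2
  refine mem_facesOff.2 ⟨φ + ε • ψ, fun i hi => ?_, by simpa using hε2, ?_⟩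
  · by_cases h : φ (x i) = 0
    · have hiF : i ∈ F := h3 ▸ mem_zeroSet.2 ⟨hi, h⟩
      simp only [LinearMap.add_apply, LinearMap.smul_apply, smul_eq_mul, h, hψ i hiF]
      split_ifs <;> simp [hε0.le]
    · simpa using (hε1 i hi h).le
  · ext i
    rw [mem_zeroSet]
    constructor
    · rintro ⟨hi, h⟩
      simp only [LinearMap.add_apply, LinearMap.smul_apply, smul_eq_mul] at h
      by_cases h0 : φ (x i) = 0
      · have hiF : i ∈ F := h3 ▸ mem_zeroSet.2 ⟨hi, h0⟩
        by_contra hiG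
        rw [h0, hψ i hiF, if_neg hiG] at h
        linarith
      · exact absurd h (hε1 i hi h0).ne'
    · intro hi
      refine ⟨subset_of_mem_facesOff hF (hG hi), ?_⟩
      simp [hval i (hG hi), hψ i (hG hi), hi]

/-- The link inequality for a sweep through all of `V`. -/
lemma hvec_lcount_facesOff_le [DecidableEq ι] [FiniteDimensional ℝ W] {V : Finset ι} {x : ι → W}
    {O : W} {D : ℕ} (hW : Module.finrank ℝ W = D + 2)
    (hspan : ∀ ψ : Module.Dual ℝ W, (∀ i ∈ V, ψ (x i) = 0) → ψ = 0)
    (hind : ∀ G ∈ facesOff V x O, LinearIndepOn ℝ x (G : Set ι))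
    {u : ι} (hu : u ∈ V) {k : ℕ} (hk : k ≤ D) :
    hvec D (lcount (facesOff V x O) u) k ≤ hvec (D + 1) (fcount (facesOff V x O)) k := by
  refine hvec_lcount_le (x := x) (O := O) hW _ subset_rfl
    (fun G hG => exists_normalized_of_mem_facesOff hG) ?_ hind (fun ψ _ h => hspan ψ h) ?_ hu hk
  · intro G _ φ h1 h2 _
    exact mem_facesOff.2 ⟨φ, h1, by rw [h2]; exact one_pos, rfl⟩
  · intro F hF G hG _ _ _ _ _ _ _
    exact mem_facesOff_of_subset hF (hind F hF) hG

lemma notMem_of_pos {V : Finset ι} {x : ι → W} {φ : Module.Dual ℝ W} {i : ι}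
    (h : 0 < φ (x i)) : i ∉ zeroSet V x φ := fun hi => h.ne' (mem_zeroSet.1 hi).2

lemma pos_of_notMem {V : Finset ι} {x : ι → W} {φ : Module.Dual ℝ W}
    (h1 : ∀ i ∈ V, 0 ≤ φ (x i)) {i : ι} (hi : i ∈ V) (h : i ∉ zeroSet V x φ) : 0 < φ (x i) :=
  lt_of_le_of_ne (h1 i hi) fun h0 => h (mem_zeroSet.2 ⟨hi, h0.symm⟩)

/-- Positivity at the sum of a subfamily means that the zero set does not contain it. -/
lemma dual_sum_pos_iff {V U : Finset ι} {x : ι → W} {φ : Module.Dual ℝ W} (hU : U ⊆ V)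
    (h1 : ∀ i ∈ V, 0 ≤ φ (x i)) : 0 < φ (∑ i ∈ U, x i) ↔ ¬ U ⊆ zeroSet V x φ := by
  rw [map_sum, Finset.sum_pos_iff_of_nonneg fun i hi => h1 i (hU hi)]
  constructor
  · rintro ⟨i, hi, h⟩ hsub
    exact notMem_of_pos h (hsub hi)
  · intro h
    obtain ⟨i, hi, hn⟩ := Finset.not_subset.1 h
    exact ⟨i, hi, pos_of_notMem h1 (hU hi) hn⟩

/-- The upper bound for the `g`-vector of a simplicial polytope, in homogeneous form. -/
theorem hvec_fcount_boundary_le [FiniteDimensional ℝ W] {V : Finset ι} {x : ι → W}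
    {d : ℕ} (hd : 1 ≤ d) (hW : Module.finrank ℝ W = d + 1) (hn : d + 1 ≤ V.card)
    (hspan : ∀ ψ : Module.Dual ℝ W, (∀ i ∈ V, ψ (x i) = 0) → ψ = 0)
    (hind : ∀ G ∈ facesOff V x (∑ i ∈ V, x i), LinearIndepOn ℝ x (G : Set ι))
    {k : ℕ} (hk : k ≤ d) :
    hvec (d + 1) (fcount (facesOff V x (∑ i ∈ V, x i))) k ≤ ubTerm V.card d k := by
  classical
  obtain ⟨D, rfl⟩ : ∃ D, d = D + 1 := ⟨d - 1, by omega⟩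
  obtain ⟨v, hv⟩ : V.Nonempty := by
    rw [← Finset.card_pos]; omega
  set B := facesOff V x (∑ i ∈ V, x i) with hB
  set A := facesOff V x (x v) with hA
  have hAB : ∀ G, G ∈ A ↔ G ∈ B ∧ v ∉ G := by
    intro G
    rw [hA, hB, mem_facesOff, mem_facesOff]
    constructor
    · rintro ⟨φ, h1, h2, rfl⟩
      exact ⟨⟨φ, h1, (dual_sum_pos_iff subset_rfl h1).2 fun h => notMem_of_pos h2 (h hv), rfl⟩,
        notMem_of_pos h2⟩
    · rintro ⟨⟨φ, h1, -, rfl⟩, h3⟩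
      exact ⟨φ, h1, pos_of_notMem h1 hv h3, rfl⟩
  have hlink : ∀ u ∈ V, ∀ k ≤ D, hvec D (lcount A u) k ≤ hvec (D + 1) (fcount A) k :=
    fun u hu k hk => hvec_lcount_facesOff_le hW hspan (fun G hG => hind G ((hAB G).1 hG).1) hu hk
  have hlv : lcount A v = 0 := by
    funext i
    rw [lcount, Finset.filter_false_of_mem]
    · rfl
    · exact fun G hG h => ((hAB G).1 hG).2 h.1
  have hast : ∀ k ≤ D + 1, hvec (D + 1) (fcount A) k ≤ ubTerm V.card (D + 1) k := by
    intro k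
    induction k with
    | zero =>
      intro _
      rw [hvec_zero, ubTerm_zero]
      exact_mod_cast fcount_zero_le A
    | succ k ih =>
      intro hk
      have h1 := hvec_derivative (D := D) (k := k) (by omega) (fcount A)
      simp only [← sum_lcount A V fun G hG => subset_of_mem_facesOff hG] at h1
      rw [hvec_sum, ← Finset.add_sum_erase _ _ hv, hlv] at h1
      have h2 : hvec D 0 k = 0 := by simp [hvec]
      rw [h2, zero_add] at h1
      have h3 := Finset.sum_le_card_nsmul (V.erase v) (fun u => hvec D (lcount A u) k) _
        fun u hu => hlink u (Finset.mem_of_mem_erase hu) k (by omega)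
      rw [h1, Finset.card_erase_of_mem hv, nsmul_eq_mul, Nat.cast_sub (by omega)] at h3
      have h4 := ih (by omega)
      have h5 := succ_mul_ubTerm (k := k) hn
      have h6 : (0 : ℤ) ≤ (V.card : ℤ) - (D + 1 : ℕ) - 1 + k := by
        have : ((D + 1 + 1 : ℕ) : ℤ) ≤ V.card := by exact_mod_cast hn
        push_cast at this ⊢
        linarith
      have h7 := mul_le_mul_of_nonneg_left h4 h6
      rw [← h5] at h7
      push_cast at h3 h7
      have h8 : ((k : ℤ) + 1) * hvec (D + 1) (fcount A) (k + 1)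
          ≤ (k + 1) * ubTerm V.card (D + 1) (k + 1) := by linarith
      exact le_of_mul_le_mul_left h8 (by positivity)
  rcases k with _ | j
  · rw [hvec_zero, ubTerm_zero]
    exact_mod_cast fcount_zero_le B
  · have hfc : ∀ i, fcount B i = fcount A i + if i = 0 then 0 else lcount B v (i - 1) := by
      intro i
      have hsplit := Finset.card_filter_add_card_filter_not (s := B.filter fun G => G.card = i)
        (fun G => v ∉ G)
      have e1 : (B.filter fun G => G.card = i).filter (fun G => v ∉ G)
          = A.filter fun G => G.card = i := by
        ext G
        simp only [Finset.mem_filter, hAB]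
        tauto
      rw [e1] at hsplit
      unfold fcount
      rw [← hsplit, Nat.cast_add]
      congr 1
      rcases i with _ | i
      · rw [if_pos rfl, Nat.cast_eq_zero, Finset.card_eq_zero, Finset.filter_eq_empty_iff]
        intro G hG
        have := (Finset.mem_filter.1 hG).2
        rw [Finset.card_eq_zero] at this
        simp [this]
      · rw [if_neg (by omega), lcount, Finset.filter_filter]
        simp only [not_not, Nat.add_sub_cancel]
        congr 2
        ext G
        simp only [Finset.mem_filter]
        tauto
    have h1 : hvec (D + 1) (fcount B) (j + 1)
        = hvec (D + 1) (fcount A) (j + 1) + hvec D (lcount B v) j := by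
      have h := hvec_add (D + 1) (j + 1) (fcount A) (fun i => if i = 0 then 0 else lcount B v (i - 1))
      rw [hvec_shift (f := fun i => if i = 0 then 0 else lcount B v (i - 1)) (by simp)] at h
      rw [show fcount B = _ from funext hfc, h]
      simp
    have h2 := hvec_lcount_facesOff_le (k := j) hW hspan hind hv (by omega)
    rw [hvec_succ_dim hk, h1]
    have h3 := hast (j + 1) hk
    linarith

end Faces

section Cayley

variable {ι W : Type*} [DecidableEq ι] [AddCommGroup W] [Module ℝ W]

/-- Homogeneous form of the Cayley setup: the vectors `x i`, `i ∈ V1`, span the kernel of `ℓ1`,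
the vectors `x i`, `i ∈ V2`, span the kernel of `ℓ2`, and all faces other than `V1` and `V2` of the
cone they span are simplicial. -/
structure CayleySystem (d : ℕ) (V1 V2 : Finset ι) (x : ι → W) (ℓ1 ℓ2 : Module.Dual ℝ W) :
    Prop where
  finrank_eq : Module.finrank ℝ W = d + 2
  zero1 : ∀ i ∈ V1, ℓ1 (x i) = 0
  one1 : ∀ i ∈ V2, ℓ1 (x i) = 1
  zero2 : ∀ i ∈ V2, ℓ2 (x i) = 0
  one2 : ∀ i ∈ V1, ℓ2 (x i) = 1
  ker1 : ∀ ψ : Module.Dual ℝ W, (∀ i ∈ V1, ψ (x i) = 0) → ∃ r : ℝ, ψ = r • ℓ1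
  ker2 : ∀ ψ : Module.Dual ℝ W, (∀ i ∈ V2, ψ (x i) = 0) → ∃ r : ℝ, ψ = r • ℓ2
  card1 : d + 1 ≤ V1.card
  card2 : d + 1 ≤ V2.card
  indep : ∀ φ : Module.Dual ℝ W, (∀ i ∈ V1 ∪ V2, 0 ≤ φ (x i)) → φ ≠ 0 →
    zeroSet (V1 ∪ V2) x φ ≠ V1 → zeroSet (V1 ∪ V2) x φ ≠ V2 →
      LinearIndepOn ℝ x (zeroSet (V1 ∪ V2) x φ : Set ι)

/-- The proper faces meeting both `V1` and `V2`. -/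
def mixedFaces (V1 V2 : Finset ι) (x : ι → W) : Finset (Finset ι) :=
  (facesOff (V1 ∪ V2) x (∑ i ∈ V1 ∪ V2, x i)).filter fun G => ¬ G ⊆ V1 ∧ ¬ G ⊆ V2

lemma mixedFaces_comm (V1 V2 : Finset ι) (x : ι → W) : mixedFaces V1 V2 x = mixedFaces V2 V1 x := by
  unfold mixedFaces
  rw [Finset.union_comm]
  exact Finset.filter_congr fun _ _ => and_comm

/-- The face numbers of the mixed faces, with the convention that the zeroth one is `-1`. -/
def mixedCount (V1 V2 : Finset ι) (x : ι → W) (i : ℕ) : ℤ :=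
  if i = 0 then -1 else fcount (mixedFaces V1 V2 x) i

namespace CayleySystem

variable {d : ℕ} {V1 V2 : Finset ι} {x : ι → W} {ℓ1 ℓ2 : Module.Dual ℝ W}

lemma symm (S : CayleySystem d V1 V2 x ℓ1 ℓ2) : CayleySystem d V2 V1 x ℓ2 ℓ1 where
  finrank_eq := S.finrank_eq
  zero1 := S.zero2
  one1 := S.one2
  zero2 := S.zero1
  one2 := S.one1
  ker1 := S.ker2
  ker2 := S.ker1
  card1 := S.card2
  card2 := S.card1
  indep := by
    intro φ
    rw [Finset.union_comm]
    exact fun h1 h2 h3 h4 => S.indep φ h1 h2 h4 h3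

lemma nonempty1 (S : CayleySystem d V1 V2 x ℓ1 ℓ2) : V1.Nonempty := by
  rw [← Finset.card_pos]
  have := S.card1
  omega

lemma nonempty2 (S : CayleySystem d V1 V2 x ℓ1 ℓ2) : V2.Nonempty := S.symm.nonempty1

lemma disjoint (S : CayleySystem d V1 V2 x ℓ1 ℓ2) : Disjoint V1 V2 := by
  rw [Finset.disjoint_left]
  intro i h1 h2
  have := S.one1 i h2
  rw [S.zero1 i h1] at this
  exact zero_ne_one this

lemma eq_zero (S : CayleySystem d V1 V2 x ℓ1 ℓ2) {ψ : Module.Dual ℝ W}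
    (h1 : ∀ i ∈ V1, ψ (x i) = 0) {j : ι} (hj : j ∈ V2) (h2 : ψ (x j) = 0) : ψ = 0 := by
  obtain ⟨r, rfl⟩ := S.ker1 ψ h1
  simp only [LinearMap.smul_apply, S.one1 j hj, smul_eq_mul, mul_one] at h2
  rw [h2, zero_smul]

/-- A face containing all of `V1` and meeting `V2` is everything. -/
lemma not_subset_of_mem_mixedFaces (S : CayleySystem d V1 V2 x ℓ1 ℓ2) {G : Finset ι}
    (hG : G ∈ mixedFaces V1 V2 x) : ¬ V1 ⊆ G := by
  rw [mixedFaces, Finset.mem_filter, mem_facesOff] at hG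
  obtain ⟨⟨φ, h1, h2, rfl⟩, h3, -⟩ := hG
  intro hsub
  obtain ⟨j, hj, hj1⟩ := Finset.not_subset.1 h3
  rw [mem_zeroSet, Finset.mem_union] at hj
  have := S.eq_zero (fun i hi => (mem_zeroSet.1 (hsub hi)).2) (hj.1.resolve_left hj1) hj.2
  rw [this] at h2
  simp at h2

lemma linearIndepOn (S : CayleySystem d V1 V2 x ℓ1 ℓ2) {G : Finset ι} {O : W}
    (hG : G ∈ facesOff (V1 ∪ V2) x O) (h1 : G ≠ V1) (h2 : G ≠ V2) :
    LinearIndepOn ℝ x (G : Set ι) := by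
  obtain ⟨φ, h3, h4, rfl⟩ := mem_facesOff.1 hG
  refine S.indep φ h3 ?_ h1 h2
  rintro rfl
  simp at h4

/-- Adding a large multiple of `ℓ2` turns a face of `V2` into a face of `V1 ∪ V2`. -/
lemma exists_extend (S : CayleySystem d V1 V2 x ℓ1 ℓ2) (φ : Module.Dual ℝ W) :
    ∃ φ' : Module.Dual ℝ W, (∀ i ∈ V1, 0 < φ' (x i)) ∧
      ∀ i ∈ V2, φ' (x i) = φ (x i) := by
  obtain ⟨t, ht⟩ : ∃ t : ℝ, ∀ i ∈ V1, -φ (x i) < t := by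
    obtain ⟨j, hj, hmax⟩ := Finset.exists_max_image V1 (fun i => -φ (x i)) S.nonempty1
    exact ⟨-φ (x j) + 1, fun i hi => by linarith [hmax i hi]⟩
  refine ⟨φ + t • ℓ2, fun i hi => ?_, fun i hi => ?_⟩
  · simp only [LinearMap.add_apply, LinearMap.smul_apply, S.one2 i hi, smul_eq_mul]
    linarith [ht i hi]
  · simp [S.zero2 i hi]

/-- The proper faces of `V2` are the faces of `V1 ∪ V2` properly contained in `V2`. -/
lemma mem_facesOff_right_iff (S : CayleySystem d V1 V2 x ℓ1 ℓ2) {G : Finset ι} :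
    G ∈ facesOff V2 x (∑ i ∈ V2, x i) ↔
      G ∈ facesOff (V1 ∪ V2) x (∑ i ∈ V2, x i) ∧ G ⊆ V2 := by
  rw [mem_facesOff, mem_facesOff]
  constructor
  · rintro ⟨φ, h1, h2, rfl⟩
    refine ⟨?_, zeroSet_subset _ _ _⟩
    obtain ⟨φ', h3, h4⟩ := S.exists_extend φ
    refine ⟨φ', fun i hi => ?_, ?_, ?_⟩
    · rcases Finset.mem_union.1 hi with hi | hi
      · exact (h3 i hi).le
      · exact h4 i hi ▸ h1 i hi
    · rw [map_sum] at h2 ⊢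
      rwa [Finset.sum_congr rfl h4]
    · ext i
      simp only [mem_zeroSet, Finset.mem_union]
      constructor
      · rintro ⟨hi | hi, h⟩
        · exact absurd h (h3 i hi).ne'
        · exact ⟨hi, h4 i hi ▸ h⟩
      · exact fun h => ⟨Or.inr h.1, (h4 i h.1).trans h.2⟩
  · rintro ⟨⟨φ, h1, h2, rfl⟩, hsub⟩
    refine ⟨φ, fun i hi => h1 i (Finset.mem_union_right _ hi), h2, ?_⟩
    ext i
    simp only [mem_zeroSet, Finset.mem_union]
    exact ⟨fun h => ⟨Or.inr h.1, h.2⟩,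
      fun h => ⟨hsub (mem_zeroSet.2 ⟨Finset.mem_union.2 h.1, h.2⟩), h.2⟩⟩

lemma finrank_ker (S : CayleySystem d V1 V2 x ℓ1 ℓ2) [FiniteDimensional ℝ W] :
    Module.finrank ℝ (LinearMap.ker ℓ2) = d + 1 := by
  have h := LinearMap.finrank_range_add_finrank_ker ℓ2
  obtain ⟨i, hi⟩ := S.nonempty1
  have hs : Function.Surjective ℓ2 := fun r => ⟨r • x i, by simp [S.one2 i hi]⟩
  rw [LinearMap.range_eq_top.2 hs, finrank_top, Module.finrank_self, S.finrank_eq] at h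
  omega

/-- The upper bound for the `g`-vector of the boundary complex of `V2`. -/
lemma hvec_right_le (S : CayleySystem d V1 V2 x ℓ1 ℓ2) [FiniteDimensional ℝ W] (hd : 1 ≤ d)
    {k : ℕ} (hk : k ≤ d) :
    hvec (d + 1) (fcount (facesOff V2 x (∑ i ∈ V2, x i))) k ≤ ubTerm V2.card d k := by
  obtain ⟨v, hv⟩ := S.nonempty1
  have hmem : ∀ i, x i - ℓ2 (x i) • x v ∈ LinearMap.ker ℓ2 := fun i => by
    simp [S.one2 v hv]
  let y : ι → LinearMap.ker ℓ2 := fun i => ⟨x i - ℓ2 (x i) • x v, hmem i⟩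
  have hy : ∀ i ∈ V2, (y i : W) = x i := fun i hi => by simp [y, S.zero2 i hi]
  have hsum : ((∑ i ∈ V2, y i : LinearMap.ker ℓ2) : W) = ∑ i ∈ V2, x i := by
    rw [Submodule.coe_sum]
    exact Finset.sum_congr rfl hy
  have hext : ∀ ψ : Module.Dual ℝ (LinearMap.ker ℓ2), ∃ φ : Module.Dual ℝ W,
      φ.comp (LinearMap.ker ℓ2).subtype = ψ := fun ψ => LinearMap.exists_extend ψ
  have hval : ∀ φ : Module.Dual ℝ W, ∀ i ∈ V2,
      φ.comp (LinearMap.ker ℓ2).subtype (y i) = φ (x i) := fun φ i hi => by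
    simp [hy i hi]
  have hfaces : facesOff V2 y (∑ i ∈ V2, y i) = facesOff V2 x (∑ i ∈ V2, x i) := by
    have key : ∀ φ : Module.Dual ℝ W, zeroSet V2 y (φ.comp (LinearMap.ker ℓ2).subtype)
        = zeroSet V2 x φ := fun φ => by
      ext i
      simp only [mem_zeroSet]
      exact and_congr_right fun hi => by rw [hval φ i hi]
    ext G
    rw [mem_facesOff, mem_facesOff]
    constructor
    · rintro ⟨ψ, h1, h2, rfl⟩
      obtain ⟨φ, rfl⟩ := hext ψ
      refine ⟨φ, fun i hi => hval φ i hi ▸ h1 i hi, ?_, (key φ).symm⟩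
      rwa [LinearMap.comp_apply, Submodule.subtype_apply, hsum] at h2
    · rintro ⟨φ, h1, h2, rfl⟩
      refine ⟨φ.comp (LinearMap.ker ℓ2).subtype, fun i hi => (hval φ i hi).symm ▸ h1 i hi, ?_,
        key φ⟩
      rwa [LinearMap.comp_apply, Submodule.subtype_apply, hsum]
  rw [← hfaces]
  refine hvec_fcount_boundary_le hd S.finrank_ker S.card2 ?_ ?_ hk
  · intro ψ hψ
    obtain ⟨φ, rfl⟩ := hext ψ
    obtain ⟨r, rfl⟩ := S.ker2 φ fun i hi => hval φ i hi ▸ hψ i hi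
    ext ⟨w, hw⟩
    simp [LinearMap.mem_ker.1 hw]
  · intro G hG
    rw [hfaces] at hG
    have hGV := subset_of_mem_facesOff hG
    have hG2 : G ≠ V2 := by
      obtain ⟨φ, h1, h2, rfl⟩ := mem_facesOff.1 hG
      exact fun h => (dual_sum_pos_iff subset_rfl h1).1 h2 h.ge
    have hG1 : G ≠ V1 := by
      rintro rfl
      exact Finset.disjoint_left.1 S.disjoint hv (hGV hv)
    have hli := S.linearIndepOn (S.mem_facesOff_right_iff.1 hG).1 hG1 hG2
    have : LinearIndepOn ℝ ((LinearMap.ker ℓ2).subtype ∘ y) (G : Set ι) :=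
      hli.congr fun i hi => (hy i (hGV hi)).symm
    exact LinearIndependent.of_comp _ this

/-- The faces not containing `V2` and not contained in `V1`. -/
lemma mem_star_iff (S : CayleySystem d V1 V2 x ℓ1 ℓ2) {G : Finset ι} :
    (G ∈ facesOff (V1 ∪ V2) x (∑ i ∈ V2, x i) ∧ ¬ G ⊆ V1) ↔
      G ∈ mixedFaces V1 V2 x ∨ (G ∈ facesOff V2 x (∑ i ∈ V2, x i) ∧ G.Nonempty) := by
  constructor
  · rintro ⟨hG, h1⟩
    by_cases h2 : G ⊆ V2
    · refine Or.inr ⟨S.mem_facesOff_right_iff.2 ⟨hG, h2⟩, ?_⟩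
      obtain ⟨i, hi, -⟩ := Finset.not_subset.1 h1
      exact ⟨i, hi⟩
    · refine Or.inl (Finset.mem_filter.2 ⟨?_, h1, h2⟩)
      obtain ⟨φ, h3, h4, rfl⟩ := mem_facesOff.1 hG
      refine mem_facesOff.2 ⟨φ, h3, (dual_sum_pos_iff subset_rfl h3).2 fun h => ?_, rfl⟩
      exact (dual_sum_pos_iff Finset.subset_union_right h3).1 h4
        (Finset.subset_union_right.trans h)
  · rintro (hG | ⟨hG, i, hi⟩)
    · have hsub : ¬ V2 ⊆ G := S.symm.not_subset_of_mem_mixedFaces (by rwa [mixedFaces_comm])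
      rw [mixedFaces, Finset.mem_filter, mem_facesOff] at hG
      obtain ⟨⟨φ, h1, h2, rfl⟩, h3, -⟩ := hG
      exact ⟨mem_facesOff.2 ⟨φ, h1, (dual_sum_pos_iff Finset.subset_union_right h1).2 hsub, rfl⟩, h3⟩
    · obtain ⟨h1, h2⟩ := S.mem_facesOff_right_iff.1 hG
      exact ⟨h1, fun h => Finset.disjoint_left.1 S.disjoint (h hi) (h2 hi)⟩

/-- The link inequality for the mixed faces. -/
lemma hvec_lcount_mixedFaces_le (S : CayleySystem d V1 V2 x ℓ1 ℓ2) [FiniteDimensional ℝ W]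
    {u : ι} (hu : u ∈ V1) {k : ℕ} (hk : k ≤ d) :
    hvec d (lcount (mixedFaces V1 V2 x) u) k
      ≤ hvec (d + 1) (mixedCount V1 V2 x) k
        + hvec (d + 1) (fcount (facesOff V2 x (∑ i ∈ V2, x i))) k := by
  set Γ := (facesOff (V1 ∪ V2) x (∑ i ∈ V2, x i)).filter fun G => ¬ G ⊆ V1 with hΓ
  have hmem : ∀ {G}, G ∈ Γ ↔ G ∈ mixedFaces V1 V2 x ∨
      (G ∈ facesOff V2 x (∑ i ∈ V2, x i) ∧ G.Nonempty) := by
    intro G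
    rw [hΓ, Finset.mem_filter]
    exact S.mem_star_iff
  have hΓind : ∀ G ∈ Γ, LinearIndepOn ℝ x (G : Set ι) := by
    intro G hG
    rw [hΓ, Finset.mem_filter] at hG
    refine S.linearIndepOn hG.1 (fun h => hG.2 h.le) ?_
    rintro rfl
    obtain ⟨φ, h1, h2, h3⟩ := mem_facesOff.1 hG.1
    exact (dual_sum_pos_iff Finset.subset_union_right h1).1 h2 h3.ge
  have hl : lcount Γ u = lcount (mixedFaces V1 V2 x) u := by
    funext i
    unfold lcount
    congr 2
    ext G
    rw [Finset.mem_filter (s := Γ), hmem, Finset.mem_filter]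
    constructor
    · rintro ⟨h | h, h1, h2⟩
      · exact ⟨h, h1, h2⟩
      · exact absurd (subset_of_mem_facesOff h.1 h1) (Finset.disjoint_left.1 S.disjoint hu)
    · exact fun h => ⟨Or.inl h.1, h.2⟩
  have hf : ∀ i, fcount Γ i = mixedCount V1 V2 x i
      + fcount (facesOff V2 x (∑ i ∈ V2, x i)) i := by
    intro i
    rcases i with _ | i
    · have h0 : ∅ ∈ facesOff V2 x (∑ i ∈ V2, x i) := by
        have h1 : ∀ i ∈ V2, 0 ≤ ℓ1 (x i) := fun i hi => by rw [S.one1 i hi]; exact zero_le_one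
        have h2 : zeroSet V2 x ℓ1 = ∅ := by
          refine Finset.eq_empty_of_forall_notMem fun i hi => ?_
          have := mem_zeroSet.1 hi
          rw [S.one1 i this.1] at this
          exact one_ne_zero this.2
        refine mem_facesOff.2 ⟨ℓ1, h1, (dual_sum_pos_iff subset_rfl h1).2 ?_, h2⟩
        rw [h2, Finset.subset_empty]
        exact S.nonempty2.ne_empty
      have h1 : Γ.filter (fun G => G.card = 0) = ∅ := by
        rw [Finset.filter_eq_empty_iff]
        intro G hG hc
        rw [Finset.card_eq_zero] at hc
        subst hc
        exact (Finset.mem_filter.1 hG).2 (Finset.empty_subset _)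
      have h2 : (facesOff V2 x (∑ i ∈ V2, x i)).filter (fun G => G.card = 0) = {∅} := by
        ext G
        simp only [Finset.mem_filter, Finset.card_eq_zero, Finset.mem_singleton]
        exact ⟨fun h => h.2, fun h => ⟨h ▸ h0, h⟩⟩
      rw [fcount, fcount, mixedCount, h1, h2]
      simp
    · simp only [mixedCount, if_neg (Nat.succ_ne_zero i), fcount]
      rw [← Nat.cast_add, ← Finset.card_union_of_disjoint]
      · congr 2
        ext G
        simp only [Finset.mem_filter, Finset.mem_union, hmem]
        constructor
        · rintro ⟨h | h, hc⟩
          · exact Or.inl ⟨h, hc⟩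
          · exact Or.inr ⟨h.1, hc⟩
        · rintro (h | h)
          · exact ⟨Or.inl h.1, h.2⟩
          · exact ⟨Or.inr ⟨h.1, Finset.card_pos.1 (by omega)⟩, h.2⟩
      · rw [Finset.disjoint_left]
        intro G h1 h2
        rw [Finset.mem_filter] at h1 h2
        exact (Finset.mem_filter.1 h1.1).2.2 (subset_of_mem_facesOff h2.1)
  rw [← hl, ← hvec_add, ← funext hf]
  refine hvec_lcount_le (x := x) (O := ∑ i ∈ V2, x i) (J := V1) (V := V1 ∪ V2) S.finrank_eq Γ
    Finset.subset_union_left ?_ ?_ hΓind ?_ ?_ hu hk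
  · exact fun G hG => exists_normalized_of_mem_facesOff (Finset.mem_filter.1 hG).1
  · intro G hG φ h1 h2 hsub
    exact Finset.mem_filter.2 ⟨mem_facesOff.2 ⟨φ, h1, by rw [h2]; exact one_pos, rfl⟩,
      fun h => (Finset.mem_filter.1 hG).2 (hsub.trans h)⟩
  · intro ψ hO hψ
    obtain ⟨r, rfl⟩ := S.ker1 ψ hψ
    rw [LinearMap.smul_apply, map_sum, Finset.sum_congr rfl S.one1] at hO
    have : (V2.card : ℝ) ≠ 0 := by exact_mod_cast S.nonempty2.card_pos.ne'
    have : r = 0 := by simpa [this] using hO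
    rw [this, zero_smul]
  · intro F hF G hG w a b hw hb hsum ha
    have hF' := Finset.mem_filter.1 hF
    refine Finset.mem_filter.2 ⟨mem_facesOff_of_subset hF'.1 (hΓind F hF) hG, fun hG1 => ?_⟩
    obtain ⟨φ, h1, h2, rfl⟩ := mem_facesOff.1 hF'.1
    have hℓ := congrArg ℓ1 hsum
    rw [map_sum, map_add, map_sum, map_smul, map_sum, Finset.sum_eq_zero, Finset.sum_congr rfl S.one1,
      Finset.sum_const, nsmul_eq_mul, mul_one, smul_eq_mul] at hℓ
    swap
    · intro j hj
      rw [map_smul, S.zero1 j hj, smul_zero]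
    have hnn : 0 ≤ ∑ i ∈ zeroSet (V1 ∪ V2) x φ, ℓ1 (a i • x i) := by
      refine Finset.sum_nonneg fun i hi => ?_
      rw [map_smul, smul_eq_mul]
      rcases Finset.mem_union.1 (mem_zeroSet.1 hi).1 with h | h
      · rw [S.zero1 i h, mul_zero]
      · rw [S.one1 i h, mul_one]
        exact ha i hi fun hiG => Finset.disjoint_left.1 S.disjoint (hG1 hiG) h
    have hcard : (0 : ℝ) < V2.card := by exact_mod_cast S.nonempty2.card_pos
    have hb0 : b = 0 := by
      have : b * V2.card ≤ 0 := by linarith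
      nlinarith
    have hφ := congrArg φ hsum
    rw [hb0, zero_smul, add_zero, map_sum, map_sum, Finset.sum_eq_zero (s := zeroSet _ _ _),
      Finset.sum_eq_zero_iff_of_nonneg] at hφ
    · have hφ0 : ∀ i ∈ V1, φ (x i) = 0 := by
        intro i hi
        have := hφ i hi
        rw [map_smul, smul_eq_mul] at this
        exact (mul_eq_zero.1 this).resolve_left (hw i hi).ne'
      obtain ⟨j, hj, hj1⟩ := Finset.not_subset.1 hF'.2
      rw [mem_zeroSet, Finset.mem_union] at hj
      have := S.eq_zero hφ0 (hj.1.resolve_left hj1) hj.2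
      rw [this] at h2
      simp at h2
    · intro i hi
      rw [map_smul, smul_eq_mul]
      exact mul_nonneg (hw i hi).le (h1 i (Finset.mem_union_left _ hi))
    · intro i hi
      rw [map_smul, (mem_zeroSet.1 hi).2, smul_zero]

/-- The upper bound for the `h`-vector of the mixed faces. -/
theorem hvec_mixedCount_le (S : CayleySystem d V1 V2 x ℓ1 ℓ2) [FiniteDimensional ℝ W]
    (hd : 1 ≤ d) {k : ℕ} (hk : k ≤ d + 1) :
    hvec (d + 1) (mixedCount V1 V2 x) k
      ≤ ubTerm (V1.card + V2.card) d k - ubTerm V1.card d k - ubTerm V2.card d k := by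
  induction k with
  | zero =>
    rw [hvec_zero, ubTerm_zero, ubTerm_zero, ubTerm_zero]
    simp [mixedCount]
  | succ k ih =>
    have h1 := hvec_derivative (D := d) (k := k) (by omega) (mixedCount V1 V2 x)
    have hmc : ∀ i : ℕ, mixedCount V1 V2 x (i + 1) = fcount (mixedFaces V1 V2 x) (i + 1) :=
      fun i => if_neg (Nat.succ_ne_zero i)
    simp only [hmc] at h1
    simp only [← sum_lcount (mixedFaces V1 V2 x) (V1 ∪ V2)
      fun G hG => subset_of_mem_facesOff (Finset.mem_filter.1 hG).1] at h1
    rw [hvec_sum, Finset.sum_union S.disjoint] at h1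
    have h2 := Finset.sum_le_card_nsmul V1 (fun u => hvec d (lcount (mixedFaces V1 V2 x) u) k)
      (hvec (d + 1) (mixedCount V1 V2 x) k + ubTerm V2.card d k) fun u hu =>
        (S.hvec_lcount_mixedFaces_le hu (by omega)).trans
          (by linarith [S.hvec_right_le hd (k := k) (by omega)])
    have hcomm : mixedCount V2 V1 x = mixedCount V1 V2 x := by
      funext i
      rw [mixedCount, mixedCount, mixedFaces_comm]
    have h3 := Finset.sum_le_card_nsmul V2 (fun u => hvec d (lcount (mixedFaces V1 V2 x) u) k)
      (hvec (d + 1) (mixedCount V1 V2 x) k + ubTerm V1.card d k) fun u hu => by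
        have h4 := S.symm.hvec_lcount_mixedFaces_le hu (k := k) (by omega)
        rw [mixedFaces_comm, hcomm] at h4
        exact h4.trans (by linarith [S.symm.hvec_right_le hd (k := k) (by omega)])
    have h4 := ih (by omega)
    have c1 := S.card1
    have c2 := S.card2
    have h5 := succ_mul_ubTerm (k := k) c1
    have h6 := succ_mul_ubTerm (k := k) c2
    have h7 := succ_mul_ubTerm (k := k) (n := V1.card + V2.card) (d := d) (by omega)
    have h8 : (0 : ℤ) ≤ ((V1.card + V2.card : ℕ) : ℤ) - d - 1 + k := by
      zify at c1
      push_cast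
      linarith [Nat.cast_nonneg (α := ℤ) V2.card, Nat.cast_nonneg (α := ℤ) k]
    have h9 := mul_le_mul_of_nonneg_left h4 h8
    rw [nsmul_eq_mul] at h2 h3
    push_cast at h7 h9
    refine le_of_mul_le_mul_left (a := (k : ℤ) + 1) ?_ (by positivity)
    rw [mul_sub, mul_sub, h5, h6, h7]
    linarith

end CayleySystem

end Cayley

/-- The `h`-vector transform is unitriangular. -/
lemma hvec_eq_iff {D l : ℕ} {f g : ℕ → ℤ} :
    (∀ k ≤ l, hvec D f k = hvec D g k) ↔ ∀ i ≤ l, f i = g i := by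
  refine ⟨fun h => ?_, fun h k hk => hvec_congr fun i hi => h i (hi.trans hk)⟩
  intro i
  induction i using Nat.strong_induction_on with
  | _ i ih =>
    intro hi
    have h1 := h i hi
    unfold hvec at h1
    rw [Finset.sum_range_succ, Finset.sum_range_succ,
      Finset.sum_congr rfl fun j hj => by
        rw [ih j (Finset.mem_range.1 hj) ((Finset.mem_range.1 hj).le.trans hi)]] at h1
    simpa using h1

section Mixed

variable {ι W : Type*} [DecidableEq ι] [AddCommGroup W] [Module ℝ W]

/-- The number of `i`-subsets of a disjoint union `V1 ∪ V2` meeting both parts. -/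
lemma card_mixed_subsets {V1 V2 : Finset ι} (h : Disjoint V1 V2) {i : ℕ} (hi : i ≠ 0) :
    ((((V1 ∪ V2).powersetCard i).filter fun G => ¬ G ⊆ V1 ∧ ¬ G ⊆ V2).card : ℤ)
      = (V1.card + V2.card).choose i - V1.card.choose i - V2.card.choose i := by
  have h1 := Finset.card_filter_add_card_filter_not (s := (V1 ∪ V2).powersetCard i)
    (fun G => ¬ G ⊆ V1 ∧ ¬ G ⊆ V2)
  have h2 : ((V1 ∪ V2).powersetCard i).filter (fun G => ¬ (¬ G ⊆ V1 ∧ ¬ G ⊆ V2))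
      = V1.powersetCard i ∪ V2.powersetCard i := by
    ext G
    simp only [Finset.mem_filter, Finset.mem_union, Finset.mem_powersetCard]
    constructor
    · rintro ⟨⟨-, hc⟩, h⟩
      tauto
    · rintro (⟨h, hc⟩ | ⟨h, hc⟩)
      · exact ⟨⟨h.trans Finset.subset_union_left, hc⟩, fun h' => h'.1 h⟩
      · exact ⟨⟨h.trans Finset.subset_union_right, hc⟩, fun h' => h'.2 h⟩
  have h3 : Disjoint (V1.powersetCard i) (V2.powersetCard i) := by
    rw [Finset.disjoint_left]
    intro G hG1 hG2
    rw [Finset.mem_powersetCard] at hG1 hG2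
    have := Finset.subset_empty.1 (h.le_bot.trans' (Finset.subset_inter hG1.1 hG2.1))
    rw [this, Finset.card_empty] at hG1
    exact hi hG1.2.symm
  rw [h2, Finset.card_union_of_disjoint h3, Finset.card_powersetCard, Finset.card_powersetCard,
    Finset.card_powersetCard, Finset.card_union_of_disjoint h] at h1
  rw [← h1]
  push_cast
  ring

namespace CayleySystem

variable {d : ℕ} {V1 V2 : Finset ι} {x : ι → W} {ℓ1 ℓ2 : Module.Dual ℝ W}

/-- The face numbers are maximal in dimensions below `l` iff all small mixed sets are faces. -/
lemma mixedCount_eq_iff (S : CayleySystem d V1 V2 x ℓ1 ℓ2) (l : ℕ) :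
    (∀ i ≤ l, mixedCount V1 V2 x i
        = (V1.card + V2.card).choose i - V1.card.choose i - V2.card.choose i) ↔
      ∀ G ⊆ V1 ∪ V2, ¬ G ⊆ V1 → ¬ G ⊆ V2 → G.card ≤ l → G ∈ mixedFaces V1 V2 x := by
  have hsub : ∀ i, (mixedFaces V1 V2 x).filter (fun G => G.card = i) ⊆
      ((V1 ∪ V2).powersetCard i).filter fun G => ¬ G ⊆ V1 ∧ ¬ G ⊆ V2 := by
    intro i G hG
    rw [mixedFaces, Finset.mem_filter, Finset.mem_filter] at hG
    exact Finset.mem_filter.2 ⟨Finset.mem_powersetCard.2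
      ⟨subset_of_mem_facesOff hG.1.1, hG.2⟩, hG.1.2⟩
  constructor
  · intro h G hG h1 h2 hl
    have hc : G.card ≠ 0 := by
      intro h0
      rw [Finset.card_eq_zero] at h0
      exact h1 (h0 ▸ Finset.empty_subset _)
    have h3 := h G.card hl
    rw [mixedCount, if_neg hc, ← card_mixed_subsets S.disjoint hc, fcount, Nat.cast_inj] at h3
    have h4 := Finset.eq_of_subset_of_card_le (hsub G.card) h3.ge
    have h5 : G ∈ (mixedFaces V1 V2 x).filter (fun G' => G'.card = G.card) := by
      rw [h4]
      exact Finset.mem_filter.2 ⟨Finset.mem_powersetCard.2 ⟨hG, rfl⟩, h1, h2⟩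
    exact (Finset.mem_filter.1 h5).1
  · intro h i hi
    by_cases h0 : i = 0
    · simp [mixedCount, h0]
    · rw [mixedCount, if_neg h0, ← card_mixed_subsets S.disjoint h0, fcount, Nat.cast_inj]
      congr 1
      refine (hsub i).antisymm fun G hG => ?_
      rw [Finset.mem_filter, Finset.mem_powersetCard] at hG
      exact Finset.mem_filter.2 ⟨h G hG.1.1 hG.2.1 hG.2.2 (by omega), hG.1.2⟩

lemma exists_dependence (S : CayleySystem d V1 V2 x ℓ1 ℓ2) [FiniteDimensional ℝ W] {p q : ι}
    (hp : p ∈ V1) (hq : q ∈ V1) : ∃ B ⊆ V2, B.card ≤ d + 1 ∧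
      ∃ c : ι → ℝ, x p - x q = ∑ i ∈ B, c i • x i := by
  obtain ⟨B, hB, -, hspan, hli⟩ := exists_linearIndepOn_extension
    (K := ℝ) (v := x) (s := ∅) (t := (V2 : Set ι)) (linearIndepOn_empty ℝ x) (Set.empty_subset _)
  lift B to Finset ι using V2.finite_toSet.subset hB
  have hB : B ⊆ V2 := by exact_mod_cast hB
  have hker : ∀ i : B, x i ∈ LinearMap.ker ℓ2 := fun i => S.zero2 i (hB i.2)
  refine ⟨B, hB, ?_, ?_⟩
  · have hli' : LinearIndependent ℝ fun i : B => (⟨x i, hker i⟩ : LinearMap.ker ℓ2) :=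
      LinearIndependent.of_comp (LinearMap.ker ℓ2).subtype hli
    have := hli'.fintype_card_le_finrank
    rwa [S.finrank_ker, Fintype.card_coe] at this
  · have hmem : x p - x q ∈ Submodule.span ℝ (x '' (B : Set ι)) := by
      by_contra hcon
      obtain ⟨ψ, hψ, hle⟩ := Submodule.exists_le_ker_of_notMem hcon
      obtain ⟨r, rfl⟩ := S.ker2 ψ fun i hi => hle (hspan ⟨i, hi, rfl⟩)
      simp [S.one2 p hp, S.one2 q hq] at hψ
    obtain ⟨c, hc⟩ :=
      (Submodule.mem_span_image_finset_iff_exists_fun' ℝ).1 hmem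
    exact ⟨c, hc.symm⟩

/-- In an affine dependence neither side can span a mixed face. -/
lemma notMem_mixedFaces_of_dependence (S : CayleySystem d V1 V2 x ℓ1 ℓ2) {p q : ι}
    (hq : q ∈ V1) (hpq : p ≠ q) {B : Finset ι} (hB : B ⊆ V2) {c : ι → ℝ}
    (hc : x p - x q = ∑ i ∈ B, c i • x i) :
    insert p (B.filter fun i => c i < 0) ∉ mixedFaces V1 V2 x := by
  intro hmem
  obtain ⟨φ, h1, -, h3⟩ := mem_facesOff.1 (Finset.mem_filter.1 hmem).1
  have hφp : φ (x p) = 0 := (mem_zeroSet.1 (h3 ▸ Finset.mem_insert_self _ _)).2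
  have h4 := congrArg φ hc
  rw [map_sub, map_sum, hφp] at h4
  have h5 : 0 ≤ ∑ i ∈ B, φ (c i • x i) := by
    refine Finset.sum_nonneg fun i hi => ?_
    rw [map_smul, smul_eq_mul]
    by_cases hneg : c i < 0
    · have : φ (x i) = 0 := (mem_zeroSet.1 (h3 ▸ Finset.mem_insert_of_mem
        (Finset.mem_filter.2 ⟨hi, hneg⟩))).2
      rw [this, mul_zero]
    · exact mul_nonneg (not_lt.1 hneg) (h1 i (Finset.mem_union_right _ (hB hi)))
  have h6 := h1 q (Finset.mem_union_left _ hq)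
  have h7 : q ∈ zeroSet (V1 ∪ V2) x φ :=
    mem_zeroSet.2 ⟨Finset.mem_union_left _ hq, by linarith⟩
  rw [h3, Finset.mem_insert, Finset.mem_filter] at h7
  rcases h7 with h | h
  · exact hpq h.symm
  · exact Finset.disjoint_left.1 S.disjoint hq (hB h.1)

/-- Not all mixed sets of size at most `⌊(d+1)/2⌋ + 1` can be faces. -/
lemma exists_notMem_mixedFaces (S : CayleySystem d V1 V2 x ℓ1 ℓ2) [FiniteDimensional ℝ W]
    (hd : 1 ≤ d) : ∃ G ⊆ V1 ∪ V2, ¬ G ⊆ V1 ∧ ¬ G ⊆ V2 ∧ G.card ≤ (d + 1) / 2 + 1 ∧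
      G ∉ mixedFaces V1 V2 x := by
  by_contra! hall
  obtain ⟨p, hp, q, hq, hpq⟩ := Finset.one_lt_card.1 (show 1 < V1.card by have := S.card1; omega)
  obtain ⟨b, hb⟩ := S.nonempty2
  have hnot1 : ∀ {i}, i ∈ V2 → i ∉ V1 := fun h h' => Finset.disjoint_left.1 S.disjoint h' h
  have hmixed : ∀ r ∈ V1, ∀ i ∈ V2, ∀ G : Finset ι, r ∈ G → i ∈ G → ¬ G ⊆ V1 ∧ ¬ G ⊆ V2 :=
    fun r hr i hi G hrG hiG => ⟨fun h => hnot1 hi (h hiG), fun h => hnot1 (h hrG) hr⟩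
  have hne : x p ≠ x q := by
    intro hx
    have h1 := hmixed p hp b hb {p, b} (by simp) (by simp)
    have h2 := hall {p, b} (by
      intro i hi
      rw [Finset.mem_insert, Finset.mem_singleton] at hi
      rcases hi with rfl | rfl <;> simp [hp, hb]) h1.1 h1.2
      (Finset.card_le_two.trans (by omega))
    obtain ⟨φ, -, -, h3⟩ := mem_facesOff.1 (Finset.mem_filter.1 h2).1
    have h4 : φ (x p) = 0 := (mem_zeroSet.1 (h3 ▸ Finset.mem_insert_self _ _)).2
    have h5 : q ∈ zeroSet (V1 ∪ V2) x φ :=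
      mem_zeroSet.2 ⟨Finset.mem_union_left _ hq, hx ▸ h4⟩
    rw [h3, Finset.mem_insert, Finset.mem_singleton] at h5
    rcases h5 with rfl | rfl
    · exact hpq rfl
    · exact hnot1 hb hq
  obtain ⟨B, hB, hBc, c, hc⟩ := S.exists_dependence hp hq
  have hsum : ∑ i ∈ B, c i = 0 := by
    have h := congrArg ℓ1 hc
    rw [map_sub, S.zero1 p hp, S.zero1 q hq, map_sum, sub_zero] at h
    rw [h]
    refine Finset.sum_congr rfl fun i hi => ?_
    rw [map_smul, S.one1 i (hB hi), smul_eq_mul, mul_one]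
  have hex : ∃ i ∈ B, c i ≠ 0 := by
    by_contra! h0
    rw [Finset.sum_eq_zero fun i hi => by rw [h0 i hi, zero_smul], sub_eq_zero] at hc
    exact hne hc
  obtain ⟨i, hi, hin⟩ := Finset.exists_pos_of_sum_zero_of_exists_nonzero (fun i => -c i)
    (by rw [Finset.sum_neg_distrib, hsum, neg_zero])
    (by simpa only [ne_eq, neg_eq_zero] using hex)
  obtain ⟨j, hj, hjp⟩ := Finset.exists_pos_of_sum_zero_of_exists_nonzero c hsum hex
  have hc' : x q - x p = ∑ i ∈ B, (-c i) • x i := by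
    simp only [neg_smul, Finset.sum_neg_distrib, ← hc, neg_sub]
  have key1 := S.notMem_mixedFaces_of_dependence hq hpq hB hc
  have key2 := S.notMem_mixedFaces_of_dependence hp hpq.symm hB hc'
  have hsubV : ∀ r ∈ V1, ∀ P : ι → Prop, ∀ [DecidablePred P], insert r (B.filter P) ⊆ V1 ∪ V2 := by
    intro r hr P _
    rw [Finset.insert_subset_iff]
    exact ⟨Finset.mem_union_left _ hr,
      (Finset.filter_subset _ _).trans (hB.trans Finset.subset_union_right)⟩
  have m1 := hmixed p hp i (hB hi) (insert p (B.filter fun i => c i < 0))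
    (Finset.mem_insert_self _ _)
    (Finset.mem_insert_of_mem (Finset.mem_filter.2 ⟨hi, by linarith⟩))
  have m2 := hmixed q hq j (hB hj) (insert q (B.filter fun i => -c i < 0))
    (Finset.mem_insert_self _ _)
    (Finset.mem_insert_of_mem (Finset.mem_filter.2 ⟨hj, by linarith⟩))
  have c1 : ¬ (insert p (B.filter fun i => c i < 0)).card ≤ (d + 1) / 2 + 1 := fun h =>
    key1 (hall _ (hsubV p hp _) m1.1 m1.2 h)
  have c2 : ¬ (insert q (B.filter fun i => -c i < 0)).card ≤ (d + 1) / 2 + 1 := fun h =>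
    key2 (hall _ (hsubV q hq _) m2.1 m2.2 h)
  have b1 := Finset.card_insert_le p (B.filter fun i => c i < 0)
  have b2 := Finset.card_insert_le q (B.filter fun i => -c i < 0)
  have hdisj : Disjoint (B.filter fun i => c i < 0) (B.filter fun i => -c i < 0) := by
    rw [Finset.disjoint_filter]
    intro i _ h
    linarith
  have b3 := Finset.card_le_card (Finset.union_subset (Finset.filter_subset (fun i => c i < 0) B)
    (Finset.filter_subset (fun i => -c i < 0) B))
  rw [Finset.card_union_of_disjoint hdisj] at b3
  omega

/-- The equality case of the upper bound. -/
theorem hvec_mixedCount_eq_iff (S : CayleySystem d V1 V2 x ℓ1 ℓ2) [FiniteDimensional ℝ W]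
    (hd : 1 ≤ d) (l : ℕ) :
    (∀ k ≤ l, hvec (d + 1) (mixedCount V1 V2 x) k
        = ubTerm (V1.card + V2.card) d k - ubTerm V1.card d k - ubTerm V2.card d k) ↔
      l ≤ (d + 1) / 2 ∧
        ∀ G ⊆ V1 ∪ V2, ¬ G ⊆ V1 → ¬ G ⊆ V2 → G.card ≤ l → G ∈ mixedFaces V1 V2 x := by
  have c1 := S.card1
  have c2 := S.card2
  have key : ∀ m ≤ d + 1, ((∀ k ≤ m, hvec (d + 1) (mixedCount V1 V2 x) k
        = ubTerm (V1.card + V2.card) d k - ubTerm V1.card d k - ubTerm V2.card d k) ↔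
      ∀ G ⊆ V1 ∪ V2, ¬ G ⊆ V1 → ¬ G ⊆ V2 → G.card ≤ m → G ∈ mixedFaces V1 V2 x) := by
    intro m hm
    rw [← S.mixedCount_eq_iff, ← hvec_eq_iff (D := d + 1) (f := mixedCount V1 V2 x)]
    refine forall₂_congr fun k hk => ?_
    rw [hvec_sub, hvec_sub, hvec_choose (hk.trans hm) (by omega), hvec_choose (hk.trans hm) c1,
      hvec_choose (hk.trans hm) c2]
    rfl
  constructor
  · intro h
    have hl : l ≤ (d + 1) / 2 := by
      by_contra! hlt
      obtain ⟨G, hG, h1, h2, h3, h4⟩ := S.exists_notMem_mixedFaces hd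
      exact h4 ((key ((d + 1) / 2 + 1) (by omega)).1 (fun k hk => h k (by omega)) G hG h1 h2 h3)
    exact ⟨hl, (key l (by omega)).1 h⟩
  · rintro ⟨hl, h⟩
    exact (key l (by omega)).2 h

end CayleySystem

end Mixed

section Homogenization

/-- The homogenization of a point. -/
def hat {N : ℕ} (p : Euc N) : Euc N × ℝ := (p, 1)

variable {N : ℕ} {V : Finset (Euc N)}

lemma map_hat (φ : Module.Dual ℝ (Euc N × ℝ)) (p : Euc N) : φ (hat p) = φ (p, 0) + φ (0, 1) := by
  rw [← map_add]
  simp [hat]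

lemma map_hat_sum (φ : Module.Dual ℝ (Euc N × ℝ)) (w : Euc N → ℝ) (hw : ∑ v ∈ V, w v = 1) :
    φ (hat (∑ v ∈ V, w v • v)) = ∑ v ∈ V, w v * φ (hat v) := by
  have h : hat (∑ v ∈ V, w v • v) = ∑ v ∈ V, w v • hat v := by
    ext1
    · simp [hat, Prod.fst_sum]
    · simp [hat, Prod.snd_sum, hw]
  rw [h, map_sum]
  simp

lemma map_hat_nonneg {φ : Module.Dual ℝ (Euc N × ℝ)} (hφ : ∀ v ∈ V, 0 ≤ φ (hat v)) {p : Euc N}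
    (hp : p ∈ convexHull ℝ (V : Set (Euc N))) : 0 ≤ φ (hat p) := by
  obtain ⟨w, hw0, hw1, rfl⟩ := Finset.mem_convexHull'.1 hp
  rw [map_hat_sum φ w hw1]
  exact Finset.sum_nonneg fun v hv => mul_nonneg (hw0 v hv) (hφ v hv)

lemma convexHull_zeroSet {φ : Module.Dual ℝ (Euc N × ℝ)} (hφ : ∀ v ∈ V, 0 ≤ φ (hat v)) :
    convexHull ℝ (zeroSet V hat φ : Set (Euc N)) =
      {p ∈ convexHull ℝ (V : Set (Euc N)) | φ (hat p) = 0} := by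
  ext p
  constructor
  · intro hp
    refine ⟨convexHull_mono (Finset.coe_subset.2 (zeroSet_subset V hat φ)) hp, ?_⟩
    obtain ⟨w, -, hw1, rfl⟩ := Finset.mem_convexHull'.1 hp
    rw [map_hat_sum φ w hw1]
    exact Finset.sum_eq_zero fun v hv => by rw [(mem_zeroSet.1 hv).2, mul_zero]
  · rintro ⟨hp, h0⟩
    obtain ⟨w, hw0, hw1, rfl⟩ := Finset.mem_convexHull'.1 hp
    rw [map_hat_sum φ w hw1,
      Finset.sum_eq_zero_iff_of_nonneg fun v hv => mul_nonneg (hw0 v hv) (hφ v hv)] at h0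
    have hz : ∀ v ∈ V, v ∉ zeroSet V hat φ → w v = 0 := fun v hv hn =>
      (mul_eq_zero.1 (h0 v hv)).resolve_right fun h => hn (mem_zeroSet.2 ⟨hv, h⟩)
    have hsub := zeroSet_subset V hat φ
    refine Finset.mem_convexHull'.2 ⟨w, fun v hv => hw0 v (hsub hv), ?_, ?_⟩
    · rw [← hw1]
      exact Finset.sum_subset hsub hz
    · exact Finset.sum_subset hsub fun v hv hn => by rw [hz v hv hn, zero_smul]

lemma isExposed_convexHull_zeroSet {φ : Module.Dual ℝ (Euc N × ℝ)}
    (hφ : ∀ v ∈ V, 0 ≤ φ (hat v)) :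
    IsExposed ℝ (convexHull ℝ (V : Set (Euc N)))
      (convexHull ℝ (zeroSet V hat φ : Set (Euc N))) := by
  rintro ⟨q, hq⟩
  rw [convexHull_zeroSet hφ] at hq ⊢
  refine ⟨LinearMap.toContinuousLinearMap (-(φ ∘ₗ LinearMap.inl ℝ (Euc N) ℝ)), ?_⟩
  ext p
  refine and_congr_right fun hp => ?_
  simp only [LinearMap.coe_toContinuousLinearMap', LinearMap.neg_apply, LinearMap.comp_apply,
    LinearMap.inl_apply, neg_le_neg_iff]
  constructor
  · intro h y hy
    have := map_hat_nonneg hφ hy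
    rw [map_hat] at h this
    linarith
  · intro h
    have h1 := map_hat_nonneg hφ hp
    have h2 := hq.2
    have h3 := h q hq.1
    rw [map_hat] at h1 h2 ⊢
    linarith

lemma exists_dual_of_isExposed {F : Set (Euc N)}
    (hF : IsExposed ℝ (convexHull ℝ (V : Set (Euc N))) F) (hne : F.Nonempty) :
    ∃ φ : Module.Dual ℝ (Euc N × ℝ), (∀ v ∈ V, 0 ≤ φ (hat v)) ∧
      F = convexHull ℝ (zeroSet V hat φ : Set (Euc N)) := by
  obtain ⟨l, rfl⟩ := hF hne
  obtain ⟨q, hq, hmax⟩ := hne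
  let φ : Module.Dual ℝ (Euc N × ℝ) :=
    l q • LinearMap.snd ℝ (Euc N) ℝ - l.toLinearMap ∘ₗ LinearMap.fst ℝ (Euc N) ℝ
  have hφ : ∀ p, φ (hat p) = l q - l p := fun p => by simp [φ, hat]
  have h0 : ∀ v ∈ V, 0 ≤ φ (hat v) := fun v hv => by
    rw [hφ, sub_nonneg]
    exact hmax v (subset_convexHull ℝ _ hv)
  refine ⟨φ, h0, ?_⟩
  rw [convexHull_zeroSet h0]
  ext p
  refine and_congr_right fun hp => ?_
  rw [hφ, sub_eq_zero]
  exact ⟨fun h => le_antisymm (h q hq) (hmax p hp), fun h y hy => h ▸ hmax y hy⟩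

lemma vertSet_convexHull_zeroSet (hV : vertSet (convexHull ℝ (V : Set (Euc N))) = V)
    {φ : Module.Dual ℝ (Euc N × ℝ)} (hφ : ∀ v ∈ V, 0 ≤ φ (hat v)) :
    vertSet (convexHull ℝ (zeroSet V hat φ : Set (Euc N))) = zeroSet V hat φ := by
  have h := (isExposed_convexHull_zeroSet hφ).isExtreme.extremePoints_eq
  rw [vertSet, h, convexHull_zeroSet hφ]
  change _ ∩ vertSet _ = _
  rw [hV]
  ext v
  simp only [mem_inter_iff, mem_ofPred_eq, Finset.mem_coe, mem_zeroSet]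
  exact ⟨fun h => ⟨h.2, h.1.2⟩, fun h => ⟨⟨subset_convexHull ℝ _ h.1, h.2⟩, h.1⟩⟩

lemma vertSet_of_mem_facesOff (hV : vertSet (convexHull ℝ (V : Set (Euc N))) = V)
    {O : Euc N × ℝ} {G : Finset (Euc N)} (hG : G ∈ facesOff V hat O) :
    vertSet (convexHull ℝ (G : Set (Euc N))) = G := by
  obtain ⟨φ, hφ, -, rfl⟩ := mem_facesOff.1 hG
  exact vertSet_convexHull_zeroSet hV hφ

lemma isProperFaceOf_convexHull_iff (hV : vertSet (convexHull ℝ (V : Set (Euc N))) = V)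
    {F : Set (Euc N)} :
    IsProperFaceOf (convexHull ℝ (V : Set (Euc N))) F ↔
      ∃ G ∈ facesOff V hat (∑ v ∈ V, hat v), G.Nonempty ∧ F = convexHull ℝ (G : Set (Euc N)) := by
  constructor
  · rintro ⟨hF, hne, hn⟩
    obtain ⟨φ, hφ, rfl⟩ := exists_dual_of_isExposed hF hn
    refine ⟨_, mem_facesOff.2 ⟨φ, hφ, ?_, rfl⟩, ?_, rfl⟩
    · rw [dual_sum_pos_iff subset_rfl hφ]
      exact fun h => hne (by rw [(zeroSet_subset V hat φ).antisymm h])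
    · simpa using hn
  · rintro ⟨G, hG, hn, rfl⟩
    obtain ⟨φ, hφ, hpos, rfl⟩ := mem_facesOff.1 hG
    refine ⟨isExposed_convexHull_zeroSet hφ, fun h => ?_, by simpa using hn⟩
    have h1 := vertSet_convexHull_zeroSet hV hφ
    rw [h, hV, Finset.coe_inj] at h1
    exact (dual_sum_pos_iff subset_rfl hφ).1 hpos h1.subset

lemma affineIndependent_coe_iff {S : Finset (Euc N)} :
    AffineIndependent ℝ (fun v : {x // x ∈ S} => (v : Euc N)) ↔
      LinearIndepOn ℝ hat (S : Set (Euc N)) := by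
  rw [affineIndependent_iff, LinearIndepOn, linearIndependent_iff']
  refine forall₂_congr fun s w => ?_
  have h : ∑ v ∈ s, w v • hat (v : Euc N) = (∑ v ∈ s, w v • (v : Euc N), ∑ v ∈ s, w v) := by
    ext1
    · simp [hat, Prod.fst_sum]
    · simp [hat, Prod.snd_sum]
  change _ ↔ (∑ v ∈ s, w v • hat (v : Euc N) = 0 → _)
  rw [h, Prod.mk_eq_zero]
  tauto

lemma IsSimplexSet.linearIndepOn {F : Set (Euc N)} (hF : IsSimplexSet F) :
    LinearIndepOn ℝ hat (vertSet F) := by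
  obtain ⟨S, hS, rfl⟩ := hF
  exact (affineIndependent_coe_iff.1 hS).mono extremePoints_convexHull_subset

lemma setDim_convexHull {G : Finset (Euc N)} (hG : LinearIndepOn ℝ hat (G : Set (Euc N)))
    (hne : G.Nonempty) : setDim (convexHull ℝ (G : Set (Euc N))) + 1 = G.card := by
  have : Nonempty {x // x ∈ G} := hne.to_subtype
  have h := (affineIndependent_coe_iff.2 hG).finrank_vectorSpan_add_one
  rw [setDim, affineSpan_convexHull, direction_affineSpan]
  have hr : range (fun v : {x // x ∈ G} => (v : Euc N)) = G := Subtype.range_coe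
  rw [hr] at h
  simpa using h

lemma eq_zero_of_full_dimensional (hdim : setDim (convexHull ℝ (V : Set (Euc N))) = N)
    (hne : V.Nonempty) {φ : Module.Dual ℝ (Euc N × ℝ)} (hφ : ∀ v ∈ V, φ (hat v) = 0) : φ = 0 := by
  rw [setDim, affineSpan_convexHull, direction_affineSpan] at hdim
  have htop : vectorSpan ℝ (V : Set (Euc N)) = ⊤ :=
    Submodule.eq_top_of_finrank_eq (by simpa using hdim)
  have hker : vectorSpan ℝ (V : Set (Euc N)) ≤
      LinearMap.ker (φ ∘ₗ LinearMap.inl ℝ (Euc N) ℝ) := by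
    rw [vectorSpan, Submodule.span_le]
    rintro _ ⟨v, hv, w, hw, rfl⟩
    have h1 := hφ v hv
    have h2 := hφ w hw
    rw [map_hat] at h1 h2
    have h3 : ((v -ᵥ w : Euc N), (0 : ℝ)) = (v, 0) - (w, 0) := by simp
    change φ ((v -ᵥ w : Euc N), 0) = 0
    rw [h3, map_sub]
    linarith
  have h0 : ∀ p : Euc N, φ (p, 0) = 0 := fun p => hker (htop ▸ Submodule.mem_top)
  obtain ⟨v, hv⟩ := hne
  have h1 : φ (0, 1) = 0 := by
    have := hφ v hv
    rwa [map_hat, h0, zero_add] at this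
  ext p <;> simp [h0, h1]

lemma IsPolytope.finite_vertSet {Q : Set (Euc N)} (hQ : IsPolytope Q) : (vertSet Q).Finite := by
  obtain ⟨S, hS, rfl⟩ := hQ
  exact hS.subset extremePoints_convexHull_subset

lemma IsPolytope.convexHull_vertSet {Q : Set (Euc N)} (hQ : IsPolytope Q) :
    convexHull ℝ (vertSet Q) = Q := by
  have hfin := hQ.finite_vertSet
  obtain ⟨S, hS, rfl⟩ := hQ
  have h := closure_convexHull_extremePoints (hS.isCompact_convexHull ℝ) (convex_convexHull ℝ S)
  exact (hfin.isClosed_convexHull ℝ).closure_eq.symm.trans h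

end Homogenization

section CayleyPolytope

variable {d : ℕ}

lemma lift_castSucc (c : ℝ) (p : Euc d) (i : Fin d) : lift c p i.castSucc = p i :=
  Fin.snoc_castSucc (α := fun _ => ℝ) c p i

lemma lift_last (c : ℝ) (p : Euc d) : lift c p (Fin.last d) = c :=
  Fin.snoc_last (α := fun _ => ℝ) c p

lemma lift_injective (c : ℝ) : Function.Injective (lift c : Euc d → Euc (d + 1)) := by
  intro p q h
  ext i
  rw [← lift_castSucc c p, h, lift_castSucc]

/-- The linear map `p ↦ (p, 0)`. -/
def liftLinear (d : ℕ) : Euc d →ₗ[ℝ] Euc (d + 1) where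
  toFun := lift 0
  map_add' p q := by
    ext i
    refine Fin.lastCases ?_ (fun i => ?_) i <;> simp [lift_last, lift_castSucc]
  map_smul' r p := by
    ext i
    refine Fin.lastCases ?_ (fun i => ?_) i <;> simp [lift_last, lift_castSucc]

lemma lift_eq (c : ℝ) (p : Euc d) : lift c p = liftLinear d p + lift c 0 := by
  ext i
  refine Fin.lastCases ?_ (fun i => ?_) i <;> simp [liftLinear, lift_last, lift_castSucc]

/-- `lift c` as an affine map. -/
def liftAffine (d : ℕ) (c : ℝ) : Euc d →ᵃ[ℝ] Euc (d + 1) where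
  toFun := lift c
  linear := liftLinear d
  map_vadd' p q := by
    rw [lift_eq c (q +ᵥ p), lift_eq c p]
    simp [add_assoc]

lemma lift_image_convexHull (c : ℝ) (s : Set (Euc d)) :
    lift c '' convexHull ℝ s = convexHull ℝ (lift c '' s) :=
  (liftAffine d c).image_convexHull s

lemma vertSet_lift_image (c : ℝ) (Q : Set (Euc d)) :
    vertSet (lift c '' Q) = lift c '' vertSet Q := by
  have hseg : ∀ p q : Euc d, openSegment ℝ (lift c p) (lift c q) = lift c '' openSegment ℝ p q :=
    fun p q => (image_openSegment ℝ (liftAffine d c) p q).symm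
  ext y
  constructor
  · rintro ⟨⟨p, hp, rfl⟩, h⟩
    refine ⟨p, ⟨hp, fun q hq r hr hm => lift_injective c ?_⟩, rfl⟩
    exact h (mem_image_of_mem _ hq) (mem_image_of_mem _ hr)
      (by rw [hseg]; exact mem_image_of_mem _ hm)
  · rintro ⟨p, ⟨hp, h⟩, rfl⟩
    refine ⟨mem_image_of_mem _ hp, ?_⟩
    rintro _ ⟨q, hq, rfl⟩ _ ⟨r, hr, rfl⟩ hm
    rw [hseg, (lift_injective c).mem_set_image] at hm
    rw [h hq hr hm]

/-- The homogeneous form of the affine functional `q ↦ q_{d+1} - c`. -/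
def heightForm (d : ℕ) (c : ℝ) : Module.Dual ℝ (Euc (d + 1) × ℝ) :=
  LinearMap.proj (Fin.last d) ∘ₗ LinearMap.fst ℝ (Euc (d + 1)) ℝ -
    c • LinearMap.snd ℝ (Euc (d + 1)) ℝ

lemma heightForm_hat_lift (c c' : ℝ) (p : Euc d) :
    heightForm d c (hat (lift c' p)) = c' - c := by
  simp [heightForm, hat, lift_last]

lemma exists_eq_smul_heightForm {v : Finset (Euc d)} (c : ℝ)
    (hdim : setDim (convexHull ℝ (v : Set (Euc d))) = d) (hne : v.Nonempty)
    {ψ : Module.Dual ℝ (Euc (d + 1) × ℝ)} (hψ : ∀ p ∈ v, ψ (hat (lift c p)) = 0) :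
    ∃ r : ℝ, ψ = r • heightForm d c := by
  let T : Euc d × ℝ →ₗ[ℝ] Euc (d + 1) × ℝ :=
    (liftLinear d ∘ₗ LinearMap.fst ℝ (Euc d) ℝ +
      (LinearMap.snd ℝ (Euc d) ℝ).smulRight (lift c 0)).prod (LinearMap.snd ℝ (Euc d) ℝ)
  have hT : ψ ∘ₗ T = 0 := by
    refine eq_zero_of_full_dimensional hdim hne fun p hp => ?_
    have h : T (hat p) = hat (lift c p) := by
      rw [lift_eq c p]
      simp [T, hat]
    rw [LinearMap.comp_apply, h, hψ p hp]
  refine ⟨ψ (lift 1 0, 0), LinearMap.ext fun y => ?_⟩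
  have hy : y = T (fun i => y.1 i.castSucc, y.2) + heightForm d c y • (lift 1 0, 0) := by
    ext i
    · refine Fin.lastCases ?_ (fun i => ?_) i <;>
        simp [T, heightForm, liftLinear, lift_last, lift_castSucc]
      ring
    · simp [T]
  have h0 := LinearMap.congr_fun hT (fun i => y.1 i.castSucc, y.2)
  rw [LinearMap.comp_apply, LinearMap.zero_apply] at h0
  conv_lhs => rw [hy, map_add, h0, map_smul, zero_add]
  simp [mul_comm]

variable {v1 v2 : Finset (Euc d)}

lemma cayley_convexHull :
    cayley (convexHull ℝ (v1 : Set (Euc d))) (convexHull ℝ (v2 : Set (Euc d))) =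
      convexHull ℝ ((v1.image (lift 0) ∪ v2.image (lift 1) : Finset (Euc (d + 1))) :
        Set (Euc (d + 1))) := by
  rw [cayley, lift_image_convexHull, lift_image_convexHull, convexHull_convexHull_union_left,
    convexHull_convexHull_union_right]
  push_cast
  rfl

lemma zeroSet_heightForm_zero :
    zeroSet (v1.image (lift 0) ∪ v2.image (lift 1)) hat (heightForm d 0) = v1.image (lift 0) := by
  ext y
  simp only [mem_zeroSet, Finset.mem_union]
  refine ⟨?_, fun hy => ⟨Or.inl hy, ?_⟩⟩
  · rintro ⟨hy | hy, h⟩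
    · exact hy
    · obtain ⟨p, -, rfl⟩ := Finset.mem_image.1 hy
      simp [heightForm_hat_lift] at h
  · obtain ⟨p, -, rfl⟩ := Finset.mem_image.1 hy
    simp [heightForm_hat_lift]

lemma zeroSet_neg_heightForm_one :
    zeroSet (v1.image (lift 0) ∪ v2.image (lift 1)) hat (-heightForm d 1) =
      v2.image (lift 1) := by
  ext y
  simp only [mem_zeroSet, Finset.mem_union]
  refine ⟨?_, fun hy => ⟨Or.inr hy, ?_⟩⟩
  · rintro ⟨hy | hy, h⟩
    · obtain ⟨p, -, rfl⟩ := Finset.mem_image.1 hy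
      simp [heightForm_hat_lift] at h
    · exact hy
  · obtain ⟨p, -, rfl⟩ := Finset.mem_image.1 hy
    simp [heightForm_hat_lift]

lemma heightForm_zero_nonneg {y : Euc (d + 1)} (hy : y ∈ v1.image (lift 0) ∪ v2.image (lift 1)) :
    0 ≤ heightForm d 0 (hat y) := by
  rcases Finset.mem_union.1 hy with hy | hy <;> obtain ⟨p, -, rfl⟩ := Finset.mem_image.1 hy <;>
    simp [heightForm_hat_lift]

lemma neg_heightForm_one_nonneg {y : Euc (d + 1)}
    (hy : y ∈ v1.image (lift 0) ∪ v2.image (lift 1)) : 0 ≤ (-heightForm d 1) (hat y) := by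
  rcases Finset.mem_union.1 hy with hy | hy <;> obtain ⟨p, -, rfl⟩ := Finset.mem_image.1 hy <;>
    simp [heightForm_hat_lift]

lemma vertSet_convexHull_image (c : ℝ) {v : Finset (Euc d)}
    (hv : vertSet (convexHull ℝ (v : Set (Euc d))) = v) :
    vertSet (convexHull ℝ (v.image (lift c) : Set (Euc (d + 1)))) = v.image (lift c) := by
  rw [Finset.coe_image, ← lift_image_convexHull, vertSet_lift_image, hv]

lemma vertSet_convexHull_union (hv1 : vertSet (convexHull ℝ (v1 : Set (Euc d))) = v1)
    (hv2 : vertSet (convexHull ℝ (v2 : Set (Euc d))) = v2) :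
    vertSet (convexHull ℝ ((v1.image (lift 0) ∪ v2.image (lift 1) : Finset (Euc (d + 1))) :
        Set (Euc (d + 1)))) = (v1.image (lift 0) ∪ v2.image (lift 1) : Finset (Euc (d + 1))) := by
  refine extremePoints_convexHull_subset.antisymm fun y hy => ?_
  have h1 := (isExposed_convexHull_zeroSet (V := v1.image (lift 0) ∪ v2.image (lift 1))
    (φ := heightForm d 0) fun y => heightForm_zero_nonneg).isExtreme
  have h2 := (isExposed_convexHull_zeroSet (V := v1.image (lift 0) ∪ v2.image (lift 1))
    (φ := -heightForm d 1) fun y => neg_heightForm_one_nonneg).isExtreme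
  rw [zeroSet_heightForm_zero] at h1
  rw [zeroSet_neg_heightForm_one] at h2
  rcases Finset.mem_union.1 (Finset.mem_coe.1 hy) with hy | hy
  · refine h1.extremePoints_subset_extremePoints ?_
    change y ∈ vertSet _
    rw [vertSet_convexHull_image 0 hv1]
    exact hy
  · refine h2.extremePoints_subset_extremePoints ?_
    change y ∈ vertSet _
    rw [vertSet_convexHull_image 1 hv2]
    exact hy

theorem cayleySystem (hv1 : vertSet (convexHull ℝ (v1 : Set (Euc d))) = v1)
    (hv2 : vertSet (convexHull ℝ (v2 : Set (Euc d))) = v2)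
    (hdim1 : setDim (convexHull ℝ (v1 : Set (Euc d))) = d)
    (hdim2 : setDim (convexHull ℝ (v2 : Set (Euc d))) = d)
    (hn1 : d + 1 ≤ v1.card) (hn2 : d + 1 ≤ v2.card)
    (hP : ∀ F, IsProperFaceOf (cayley (convexHull ℝ (v1 : Set (Euc d)))
        (convexHull ℝ (v2 : Set (Euc d)))) F →
      F ≠ lift 0 '' convexHull ℝ (v1 : Set (Euc d)) →
      F ≠ lift 1 '' convexHull ℝ (v2 : Set (Euc d)) → IsSimplexSet F) :
    CayleySystem d (v1.image (lift 0)) (v2.image (lift 1)) hat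
      (heightForm d 0) (-heightForm d 1) := by
  have hne1 : v1.Nonempty := Finset.card_pos.1 (by omega)
  have hne2 : v2.Nonempty := Finset.card_pos.1 (by omega)
  have hker1 : ∀ ψ : Module.Dual ℝ (Euc (d + 1) × ℝ),
      (∀ y ∈ v1.image (lift 0), ψ (hat y) = 0) → ∃ r : ℝ, ψ = r • heightForm d 0 :=
    fun ψ h => exists_eq_smul_heightForm 0 hdim1 hne1
      fun p hp => h _ (Finset.mem_image_of_mem _ hp)
  refine ⟨by simp, ?_, ?_, ?_, ?_, hker1, fun ψ h => ?_, ?_, ?_, fun φ hφ h0 hz1 hz2 => ?_⟩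
  · simp [heightForm_hat_lift]
  · simp [heightForm_hat_lift]
  · simp [heightForm_hat_lift]
  · simp [heightForm_hat_lift]
  · obtain ⟨r, rfl⟩ := exists_eq_smul_heightForm 1 hdim2 hne2
      fun p hp => h _ (Finset.mem_image_of_mem _ hp)
    exact ⟨-r, by simp⟩
  · rwa [Finset.card_image_of_injective _ (lift_injective 0)]
  · rwa [Finset.card_image_of_injective _ (lift_injective 1)]
  · have hV := vertSet_convexHull_union hv1 hv2
    have hvert := vertSet_convexHull_zeroSet hV hφ
    rcases (zeroSet (v1.image (lift 0) ∪ v2.image (lift 1)) hat φ).eq_empty_or_nonempty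
      with he | hne
    · rw [he, Finset.coe_empty]
      exact linearIndepOn_empty ℝ hat
    rw [← hvert]
    rw [cayley_convexHull] at hP
    refine (hP _ ⟨isExposed_convexHull_zeroSet hφ, fun h => h0 ?_, by simpa using hne⟩
      (fun h => hz1 ?_) fun h => hz2 ?_).linearIndepOn
    · rw [h, hV, Finset.coe_inj] at hvert
      have hall : ∀ y ∈ v1.image (lift 0) ∪ v2.image (lift 1), φ (hat y) = 0 := fun y hy =>
        (mem_zeroSet.1 (hvert ▸ hy)).2
      obtain ⟨r, rfl⟩ := hker1 φ fun y hy => hall y (Finset.mem_union_left _ hy)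
      obtain ⟨p, hp⟩ := hne2
      have := hall _ (Finset.mem_union_right _ (Finset.mem_image_of_mem _ hp))
      simp only [LinearMap.smul_apply, heightForm_hat_lift, sub_zero, smul_eq_mul, mul_one] at this
      rw [this, zero_smul]
    · rw [← Finset.coe_inj, ← hvert, h, vertSet_lift_image, hv1, Finset.coe_image]
    · rw [← Finset.coe_inj, ← hvert, h, vertSet_lift_image, hv2, Finset.coe_image]

end CayleyPolytope

section CayleyFaces

variable {d : ℕ} {v1 v2 : Finset (Euc d)}

lemma inter_lift_zero_nonempty_iff {G : Finset (Euc (d + 1))}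
    (hG : G ⊆ v1.image (lift 0) ∪ v2.image (lift 1)) :
    ((G : Set (Euc (d + 1))) ∩ lift 0 '' convexHull ℝ (v1 : Set (Euc d))).Nonempty ↔
      ¬ G ⊆ v2.image (lift 1) := by
  rw [Finset.not_subset]
  constructor
  · rintro ⟨_, hy, p, -, rfl⟩
    refine ⟨_, hy, fun h => ?_⟩
    obtain ⟨q, -, hq⟩ := Finset.mem_image.1 h
    have := congrFun hq (Fin.last d)
    simp [lift_last] at this
  · rintro ⟨y, hy, hn⟩
    obtain ⟨p, hp, rfl⟩ := Finset.mem_image.1 ((Finset.mem_union.1 (hG hy)).resolve_right hn)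
    exact ⟨_, hy, mem_image_of_mem _ (subset_convexHull ℝ _ hp)⟩

lemma inter_lift_one_nonempty_iff {G : Finset (Euc (d + 1))}
    (hG : G ⊆ v1.image (lift 0) ∪ v2.image (lift 1)) :
    ((G : Set (Euc (d + 1))) ∩ lift 1 '' convexHull ℝ (v2 : Set (Euc d))).Nonempty ↔
      ¬ G ⊆ v1.image (lift 0) := by
  rw [Finset.not_subset]
  constructor
  · rintro ⟨_, hy, p, -, rfl⟩
    refine ⟨_, hy, fun h => ?_⟩
    obtain ⟨q, -, hq⟩ := Finset.mem_image.1 h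
    have := congrFun hq (Fin.last d)
    simp [lift_last] at this
  · rintro ⟨y, hy, hn⟩
    obtain ⟨p, hp, rfl⟩ := Finset.mem_image.1 ((Finset.mem_union.1 (hG hy)).resolve_left hn)
    exact ⟨_, hy, mem_image_of_mem _ (subset_convexHull ℝ _ hp)⟩

lemma vertSet_of_mem_mixedFaces (hv1 : vertSet (convexHull ℝ (v1 : Set (Euc d))) = v1)
    (hv2 : vertSet (convexHull ℝ (v2 : Set (Euc d))) = v2) {G : Finset (Euc (d + 1))}
    (hG : G ∈ mixedFaces (v1.image (lift 0)) (v2.image (lift 1)) hat) :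
    vertSet (convexHull ℝ (G : Set (Euc (d + 1)))) = G :=
  vertSet_of_mem_facesOff (vertSet_convexHull_union hv1 hv2) (Finset.mem_filter.1 hG).1

lemma cayleyFaces_convexHull (hv1 : vertSet (convexHull ℝ (v1 : Set (Euc d))) = v1)
    (hv2 : vertSet (convexHull ℝ (v2 : Set (Euc d))) = v2) :
    cayleyFaces (convexHull ℝ (v1 : Set (Euc d))) (convexHull ℝ (v2 : Set (Euc d))) =
      (fun G : Finset (Euc (d + 1)) => convexHull ℝ (G : Set (Euc (d + 1)))) ''
        (mixedFaces (v1.image (lift 0)) (v2.image (lift 1)) hat :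
          Set (Finset (Euc (d + 1)))) := by
  have hV := vertSet_convexHull_union hv1 hv2
  ext F
  rw [cayleyFaces, mem_ofPred_eq, cayley_convexHull, isProperFaceOf_convexHull_iff hV]
  simp only [mem_image, Finset.mem_coe, mixedFaces, Finset.mem_filter]
  constructor
  · rintro ⟨⟨G, hG, -, rfl⟩, h1, h2⟩
    rw [vertSet_of_mem_facesOff hV hG] at h1 h2
    have hsub := subset_of_mem_facesOff hG
    exact ⟨G, ⟨hG, (inter_lift_one_nonempty_iff hsub).1 h2,
      (inter_lift_zero_nonempty_iff hsub).1 h1⟩, rfl⟩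
  · rintro ⟨G, ⟨hG, h1, h2⟩, rfl⟩
    have hsub := subset_of_mem_facesOff hG
    rw [vertSet_of_mem_facesOff hV hG]
    refine ⟨⟨G, hG, ?_, rfl⟩, (inter_lift_zero_nonempty_iff hsub).2 h2,
      (inter_lift_one_nonempty_iff hsub).2 h1⟩
    exact Finset.nonempty_iff_ne_empty.2 fun he => h1 (he ▸ Finset.empty_subset _)

lemma setDim_of_mem_mixedFaces
    (S : CayleySystem d (v1.image (lift 0)) (v2.image (lift 1)) hat
      (heightForm d 0) (-heightForm d 1)) {G : Finset (Euc (d + 1))}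
    (hG : G ∈ mixedFaces (v1.image (lift 0)) (v2.image (lift 1)) hat) :
    setDim (convexHull ℝ (G : Set (Euc (d + 1)))) + 1 = G.card := by
  obtain ⟨hG, h1, h2⟩ := Finset.mem_filter.1 hG
  exact setDim_convexHull (S.linearIndepOn hG (fun h => h1 h.subset) fun h => h2 h.subset)
    (Finset.nonempty_iff_ne_empty.2 fun he => h1 (he ▸ Finset.empty_subset _))

lemma fFm1_eq_mixedCount (hv1 : vertSet (convexHull ℝ (v1 : Set (Euc d))) = v1)
    (hv2 : vertSet (convexHull ℝ (v2 : Set (Euc d))) = v2)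
    (S : CayleySystem d (v1.image (lift 0)) (v2.image (lift 1)) hat
      (heightForm d 0) (-heightForm d 1)) (i : ℕ) :
    fFm1 (convexHull ℝ (v1 : Set (Euc d))) (convexHull ℝ (v2 : Set (Euc d))) i =
      mixedCount (v1.image (lift 0)) (v2.image (lift 1)) hat i := by
  rcases i with _ | k
  · rfl
  have himage : {F ∈ cayleyFaces (convexHull ℝ (v1 : Set (Euc d)))
      (convexHull ℝ (v2 : Set (Euc d))) | setDim F = k} =
      (fun G : Finset (Euc (d + 1)) => convexHull ℝ (G : Set (Euc (d + 1)))) ''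
        ((mixedFaces (v1.image (lift 0)) (v2.image (lift 1)) hat).filter
          fun G => G.card = k + 1 : Finset (Finset (Euc (d + 1)))) := by
    rw [cayleyFaces_convexHull hv1 hv2]
    ext F
    simp only [mem_image, Finset.mem_coe, Finset.mem_filter, mem_ofPred_eq]
    constructor
    · rintro ⟨⟨G, hG, rfl⟩, h⟩
      exact ⟨G, ⟨hG, by rw [← setDim_of_mem_mixedFaces S hG, h]⟩, rfl⟩
    · rintro ⟨G, ⟨hG, h⟩, rfl⟩
      refine ⟨⟨G, hG, rfl⟩, ?_⟩
      have := setDim_of_mem_mixedFaces S hG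
      omega
  have hinj : InjOn (fun G : Finset (Euc (d + 1)) => convexHull ℝ (G : Set (Euc (d + 1))))
      ((mixedFaces (v1.image (lift 0)) (v2.image (lift 1)) hat).filter
        fun G => G.card = k + 1 : Finset (Finset (Euc (d + 1)))) := by
    intro G hG H hH h
    have hG' := vertSet_of_mem_mixedFaces hv1 hv2 (Finset.mem_filter.1 hG).1
    have hH' := vertSet_of_mem_mixedFaces hv1 hv2 (Finset.mem_filter.1 hH).1
    rw [← Finset.coe_inj, ← hG', ← hH']
    exact congrArg vertSet h
  rw [fFm1, himage, hinj.ncard_image, ncard_coe_finset, mixedCount,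
    if_neg k.succ_ne_zero, fcount]

lemma isSimplexFaceVertexSet_iff (hv1 : vertSet (convexHull ℝ (v1 : Set (Euc d))) = v1)
    (hv2 : vertSet (convexHull ℝ (v2 : Set (Euc d))) = v2)
    (S : CayleySystem d (v1.image (lift 0)) (v2.image (lift 1)) hat
      (heightForm d 0) (-heightForm d 1)) {G : Finset (Euc (d + 1))}
    (h1 : ¬ G ⊆ v1.image (lift 0)) (h2 : ¬ G ⊆ v2.image (lift 1)) :
    IsSimplexFaceVertexSet
        (cayley (convexHull ℝ (v1 : Set (Euc d))) (convexHull ℝ (v2 : Set (Euc d)))) G ↔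
      G ∈ mixedFaces (v1.image (lift 0)) (v2.image (lift 1)) hat := by
  have hV := vertSet_convexHull_union hv1 hv2
  simp only [IsSimplexFaceVertexSet, cayley_convexHull, isProperFaceOf_convexHull_iff hV]
  constructor
  · rintro ⟨_, ⟨H, hH, -, rfl⟩, hv, -⟩
    rw [vertSet_of_mem_facesOff hV hH, Finset.coe_inj] at hv
    exact Finset.mem_filter.2 ⟨hv ▸ hH, h1, h2⟩
  · intro hG
    refine ⟨_, ⟨G, (Finset.mem_filter.1 hG).1, ?_, rfl⟩, vertSet_of_mem_mixedFaces hv1 hv2 hG, ?_⟩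
    · exact Finset.nonempty_iff_ne_empty.2 fun he => h1 (he ▸ Finset.empty_subset _)
    · rw [ncard_coe_finset, setDim_of_mem_mixedFaces S hG]

lemma polytopeBineighborly_iff (hv1 : vertSet (convexHull ℝ (v1 : Set (Euc d))) = v1)
    (hv2 : vertSet (convexHull ℝ (v2 : Set (Euc d))) = v2)
    (S : CayleySystem d (v1.image (lift 0)) (v2.image (lift 1)) hat
      (heightForm d 0) (-heightForm d 1)) (l : ℕ) :
    PolytopeBineighborly
        (cayley (convexHull ℝ (v1 : Set (Euc d))) (convexHull ℝ (v2 : Set (Euc d))))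
        (lift 0 '' vertSet (convexHull ℝ (v1 : Set (Euc d)))) l ↔
      ∀ G ⊆ v1.image (lift 0) ∪ v2.image (lift 1), ¬ G ⊆ v1.image (lift 0) →
        ¬ G ⊆ v2.image (lift 1) → G.card ≤ l →
          G ∈ mixedFaces (v1.image (lift 0)) (v2.image (lift 1)) hat := by
  have hV := vertSet_convexHull_union hv1 hv2
  have hdisj := S.disjoint
  have hsdiff : ((v1.image (lift 0) ∪ v2.image (lift 1) : Finset (Euc (d + 1))) :
      Set (Euc (d + 1))) \ (v1.image (lift 0) : Finset (Euc (d + 1))) =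
      (v2.image (lift 1) : Finset (Euc (d + 1))) := by
    rw [← Finset.coe_sdiff, Finset.union_sdiff_cancel_left hdisj]
  rw [PolytopeBineighborly, hv1, ← Finset.coe_image]
  have hVc := cayley_convexHull (v1 := v1) (v2 := v2)
  rw [← hVc] at hV
  rw [hV, hsdiff]
  constructor
  · rintro ⟨-, -, h⟩ G hG h1 h2 hcard
    rw [← isSimplexFaceVertexSet_iff hv1 hv2 S h1 h2]
    have hunion : G ∩ v1.image (lift 0) ∪ G ∩ v2.image (lift 1) = G := by
      rw [← Finset.inter_union_distrib_left, Finset.inter_eq_left.2 hG]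
    have hc : (G ∩ v1.image (lift 0)).card + (G ∩ v2.image (lift 1)).card = G.card := by
      rw [← Finset.card_union_of_disjoint
        (hdisj.mono Finset.inter_subset_right Finset.inter_subset_right), hunion]
    have := h (G ∩ v1.image (lift 0) : Finset (Euc (d + 1)))
      (G ∩ v2.image (lift 1) : Finset (Euc (d + 1))) ?_ ?_
      (Finset.coe_subset.2 Finset.inter_subset_right)
      (Finset.coe_subset.2 Finset.inter_subset_right) ?_
    · rwa [← Finset.coe_union, hunion] at this
    · obtain ⟨y, hy, hn⟩ := Finset.not_subset.1 h2
      exact ⟨y, Finset.mem_coe.2 (Finset.mem_inter.2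
        ⟨hy, (Finset.mem_union.1 (hG hy)).resolve_right hn⟩)⟩
    · obtain ⟨y, hy, hn⟩ := Finset.not_subset.1 h1
      exact ⟨y, Finset.mem_coe.2 (Finset.mem_inter.2
        ⟨hy, (Finset.mem_union.1 (hG hy)).resolve_left hn⟩)⟩
    · rw [ncard_coe_finset, ncard_coe_finset, hc]
      exact hcard
  · intro h
    obtain ⟨y1, hy1⟩ := S.nonempty1
    obtain ⟨y2, hy2⟩ := S.nonempty2
    refine ⟨⟨y1, hy1⟩, Finset.coe_ssubset.2 ⟨Finset.subset_union_left, fun hs =>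
      Finset.disjoint_left.1 hdisj (hs (Finset.mem_union_right _ hy2)) hy2⟩, ?_⟩
    intro S1 S2 hne1 hne2 hS1 hS2 hcard
    lift S1 to Finset (Euc (d + 1)) using (Finset.finite_toSet _).subset hS1
    lift S2 to Finset (Euc (d + 1)) using (Finset.finite_toSet _).subset hS2
    rw [Finset.coe_subset] at hS1 hS2
    rw [ncard_coe_finset, ncard_coe_finset] at hcard
    obtain ⟨z1, hz1⟩ := hne1
    obtain ⟨z2, hz2⟩ := hne2
    have h1 : ¬ S1 ∪ S2 ⊆ v1.image (lift 0) := fun hs =>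
      Finset.disjoint_left.1 hdisj (hs (Finset.mem_union_right _ hz2)) (hS2 hz2)
    have h2 : ¬ S1 ∪ S2 ⊆ v2.image (lift 1) := fun hs =>
      Finset.disjoint_left.1 hdisj (hS1 hz1) (hs (Finset.mem_union_left _ hz1))
    rw [← Finset.coe_union, isSimplexFaceVertexSet_iff hv1 hv2 S h1 h2]
    exact h _ (Finset.union_subset_union hS1 hS2) h1 h2 ((Finset.card_union_le _ _).trans hcard)

end CayleyFaces

/-- `h_k(𝓕) ≤ binom(n1+n2-d-2+k, k) - binom(n1-d-2+k, k) - binom(n2-d-2+k, k)`,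
with equality for all `0 ≤ k ≤ l` iff `l ≤ ⌊(d+1)/2⌋` and `P` is `(V1; l)`-bineighborly. -/
theorem statement_11
    (d n1 n2 : ℕ) (hd : 2 ≤ d)
    (P1 P2 : Set (Euc d))
    (hP1 : IsSimplicialPolytope P1) (hP2 : IsSimplicialPolytope P2)
    (hdim1 : setDim P1 = d) (hdim2 : setDim P2 = d)
    (hv1 : vertCount P1 = n1) (hv2 : vertCount P2 = n2)
    (hn1 : d + 1 ≤ n1) (hn2 : d + 1 ≤ n2)
    (hP : ∀ F : Set (Euc (d + 1)), IsProperFaceOf (cayley P1 P2) F →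
      F ≠ lift 0 '' P1 → F ≠ lift 1 '' P2 → IsSimplexSet F) :
    (∀ k : ℕ, k ≤ d + 1 →
        hF P1 P2 k ≤
          (ubTerm (n1 + n2) d k : ℤ) - (ubTerm n1 d k : ℤ) - (ubTerm n2 d k : ℤ)) ∧
      ∀ l : ℕ,
        ((∀ k : ℕ, k ≤ l →
            hF P1 P2 k =
              (ubTerm (n1 + n2) d k : ℤ) - (ubTerm n1 d k : ℤ) - (ubTerm n2 d k : ℤ)) ↔
          (l ≤ (d + 1) / 2 ∧
            PolytopeBineighborly (cayley P1 P2) (lift 0 '' vertSet P1) l)) := by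
  obtain ⟨v1, hw1⟩ := hP1.1.finite_vertSet.exists_finset_coe
  obtain ⟨v2, hw2⟩ := hP2.1.finite_vertSet.exists_finset_coe
  have hc1 := hP1.1.convexHull_vertSet
  have hc2 := hP2.1.convexHull_vertSet
  rw [vertCount, ← hw1, ncard_coe_finset] at hv1
  rw [vertCount, ← hw2, ncard_coe_finset] at hv2
  rw [← hw1] at hc1
  rw [← hw2] at hc2
  subst hc1 hc2 hv1 hv2
  have hw1 := hw1.symm
  have hw2 := hw2.symm
  have S := cayleySystem hw1 hw2 hdim1 hdim2 hn1 hn2 hP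
  have hhF : ∀ k, hF (convexHull ℝ (v1 : Set (Euc d))) (convexHull ℝ (v2 : Set (Euc d))) k =
      hvec (d + 1) (mixedCount (v1.image (lift 0)) (v2.image (lift 1)) hat) k := fun k =>
    hvec_congr (f := fFm1 _ _) fun i _ => fFm1_eq_mixedCount hw1 hw2 S i
  have hcard1 := Finset.card_image_of_injective v1 (lift_injective 0)
  have hcard2 := Finset.card_image_of_injective v2 (lift_injective 1)
  refine ⟨fun k hk => ?_, fun l => ?_⟩
  · rw [hhF, ← hcard1, ← hcard2]
    exact S.hvec_mixedCount_le (by omega) hk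
  · rw [polytopeBineighborly_iff hw1 hw2 S, ← S.hvec_mixedCount_eq_iff (by omega), hcard1, hcard2]
    simp only [hhF]
end
end

section
/- Let d ≥ 3 be odd, let 0 < α_1 < … < α_{n1} and 0 < β_1 < … < β_{n2} be real numbers, and let τ* > 0 be such that the polytope CH_{d+1}({γ1(α_i τ*;0)} ∪ {γ2(β_j;0)}) is (U1; ⌊(d+1)/2⌋)-bineighborly, where γ1(t;ζ) = (t, ζt^d, t², t³, …, t^{d−1}, 0), γ2(s;ζ) = (ζs^d, s, s², s³, …, s^{d−1}, 1), and U1 = {γ1(α_i τ*;0)}. For ζ > 0 define V1 = { γ1(α_i τ*; ζ) : 1 ≤ i ≤ n1 } and V2 = { γ2(β_j; ζ) : 1 ≤ j ≤ n2 }. Then there exists ζ* > 0 such that for ζ = ζ*, the (d+1)-polytope P = CH_{d+1}(V1∪V2) is (V1; ⌊(d+1)/2⌋)-bineighborly, i.e., every subset V of V1∪V2 of cardinality ⌊(d+1)/2⌋ meeting both V1 and V2 is the vertex set of a (⌊(d+1)/2⌋−1)-face of P. -/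
open Set Pointwise

noncomputable section

/-- If a linear functional attains its maximum over a finite family only at `p i`, then `p i` is
a vertex of the convex hull of the family. -/
theorem mem_vertSet_convexHull_range {N : ℕ} {ι : Type*} [Finite ι] {p : ι → Euc N}
    (l : StrongDual ℝ (Euc N)) (i : ι) (hl : ∀ j, j ≠ i → l (p j) < l (p i)) :
    p i ∈ vertSet (convexHull ℝ (range p)) := by
  have hle : ∀ y ∈ convexHull ℝ (range p), l y ≤ l (p i) := by
    refine convexHull_min ?_ (convex_halfSpace_le l.toLinearMap.isLinear _)
    rintro _ ⟨j, rfl⟩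
    by_cases h : j = i
    · exact (congrArg (fun k => l (p k)) h).le
    · exact (hl j h).le
  have hexp : IsExposed ℝ (convexHull ℝ (range p)) (l.toExposed (convexHull ℝ (range p))) :=
    ContinuousLinearMap.toExposed.isExposed
  have hi : p i ∈ l.toExposed (convexHull ℝ (range p)) :=
    ⟨subset_convexHull ℝ _ (mem_range_self i), hle⟩
  obtain ⟨x, hx⟩ :=
    (hexp.isCompact ((finite_range p).isCompact_convexHull ℝ)).extremePoints_nonempty ⟨_, hi⟩
  have hx' := hexp.isExtreme.extremePoints_subset_extremePoints hx
  obtain ⟨j, rfl⟩ := extremePoints_convexHull_subset hx'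
  by_cases h : j = i
  · exact h ▸ hx'
  · exact absurd (hx.1.2 _ hi.1) (hl j h).not_ge

/-- The dimension of a face of a polytope is that of the affine hull of its vertices. -/
theorem setDim_eq_finrank_vectorSpan_vertSet {N : ℕ} {s F : Set (Euc N)} (hs : s.Finite)
    (hF : IsExposed ℝ (convexHull ℝ s) F) :
    setDim F = Module.finrank ℝ (vectorSpan ℝ (vertSet F)) := by
  have hfin : (vertSet F).Finite := hs.subset fun x hx =>
    extremePoints_convexHull_subset (hF.isExtreme.extremePoints_subset_extremePoints hx)
  have hKM : closure (convexHull ℝ (vertSet F)) = F := closure_convexHull_extremePoints (hF.isCompact (hs.isCompact_convexHull ℝ))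
    (hF.convex (convex_convexHull ℝ s))
  rw [(hfin.isClosed_convexHull ℝ).closure_eq] at hKM
  rw [setDim, ← direction_affineSpan, ← affineSpan_convexHull (vertSet F)]
  exact congrArg (fun G : Set (Euc N) => Module.finrank ℝ (affineSpan ℝ G).direction) hKM.symm

theorem finrank_vectorSpan_image_add_one_iff {N : ℕ} {ι : Type*} [Finite ι] {p : ι → Euc N}
    (hp : p.Injective) {J : Set ι} (hJ : J.Nonempty) :
    Module.finrank ℝ (vectorSpan ℝ (p '' J)) + 1 = (p '' J).ncard ↔
      AffineIndependent ℝ fun j : J => p j := by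
  have := Fintype.ofFinite J
  obtain ⟨n, hn⟩ : ∃ n, J.ncard = n + 1 :=
    Nat.exists_eq_succ_of_ne_zero hJ.ncard_pos.ne'
  have hc : Fintype.card J = n + 1 := by rw [← Nat.card_eq_fintype_card]; exact hn
  rw [affineIndependent_iff_finrank_vectorSpan_eq ℝ _ hc, ncard_image_of_injective _ hp, hn,
    image_eq_range]
  exact Nat.add_right_cancel_iff

/-- A set of vertices spans a proper simplex face iff it is a proper affinely independent subset of
the vertices on which some linear functional attains its maximum, and only there. -/
theorem isSimplexFaceVertexSet_image_iff {N : ℕ} {ι : Type*} [Finite ι] {p : ι → Euc N}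
    (hp : p.Injective) (hext : ∀ i, p i ∈ vertSet (convexHull ℝ (range p)))
    {J : Set ι} (hJ : J.Nonempty) :
    IsSimplexFaceVertexSet (convexHull ℝ (range p)) (p '' J) ↔
      J ≠ univ ∧ (AffineIndependent ℝ fun j : J => p j) ∧
        ∃ (l : StrongDual ℝ (Euc N)) (c : ℝ),
          (∀ j ∈ J, l (p j) = c) ∧ ∀ i ∉ J, l (p i) < c := by
  have hmem : ∀ i, p i ∈ convexHull ℝ (range p) := fun i =>
    subset_convexHull ℝ _ (mem_range_self i)
  constructor
  · rintro ⟨F, ⟨hexp, hne, hFne⟩, hvert, hdim⟩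
    have hdim' := hdim
    rw [setDim_eq_finrank_vectorSpan_vertSet (finite_range p) hexp, hvert,
      finrank_vectorSpan_image_add_one_iff hp hJ] at hdim'
    have hvF : ∀ i, p i ∈ F → i ∈ J := fun i hi => by
      have : p i ∈ vertSet F := inter_extremePoints_subset_extremePoints_of_subset
        hexp.subset ⟨hi, hext i⟩
      rw [hvert] at this
      exact hp.mem_set_image.1 this
    have hJF : ∀ j ∈ J, p j ∈ F := fun j hj =>
      extremePoints_subset (hvert.symm.subset (mem_image_of_mem p hj) : p j ∈ vertSet F)
    refine ⟨?_, hdim', ?_⟩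
    · rintro rfl
      refine hne (hexp.subset.antisymm (convexHull_min ?_ (hexp.convex (convex_convexHull ℝ _))))
      rintro _ ⟨i, rfl⟩
      exact hJF i (mem_univ i)
    · obtain ⟨l, hl⟩ := hexp hFne
      obtain ⟨j₀, hj₀⟩ := hJ
      have hmax := (hl.subset (hJF j₀ hj₀)).2
      refine ⟨l, l (p j₀), fun j hj => ?_, fun i hi => ?_⟩
      · exact (hmax _ (hmem j)).antisymm ((hl.subset (hJF j hj)).2 _ (hmem j₀))
      · refine lt_of_not_ge fun hle => hi (hvF i ?_)
        rw [hl]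
        exact ⟨hmem i, fun y hy => (hmax y hy).trans hle⟩
  · rintro ⟨hJuniv, hind, l, c, hlJ, hlc⟩
    have hle : ∀ y ∈ convexHull ℝ (range p), l y ≤ c := by
      refine convexHull_min ?_ (convex_halfSpace_le l.toLinearMap.isLinear _)
      rintro _ ⟨i, rfl⟩
      by_cases h : i ∈ J
      · exact (hlJ i h).le
      · exact (hlc i h).le
    have hexp : IsExposed ℝ (convexHull ℝ (range p)) (l.toExposed (convexHull ℝ (range p))) :=
      ContinuousLinearMap.toExposed.isExposed
    have hiff : ∀ i, p i ∈ l.toExposed (convexHull ℝ (range p)) ↔ i ∈ J := fun i => by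
      obtain ⟨j, hj⟩ := hJ
      refine ⟨fun h => by_contra fun hi => ?_, fun h => ⟨hmem i, fun y hy => ?_⟩⟩
      · exact ((hlJ j hj).symm.le.trans (h.2 _ (hmem j))).not_gt (hlc i hi)
      · exact (hle y hy).trans (hlJ i h).ge
    have hvert : vertSet (l.toExposed (convexHull ℝ (range p))) = p '' J := by
      rw [vertSet, hexp.isExtreme.extremePoints_eq]
      ext x
      constructor
      · rintro ⟨hx, hx'⟩
        obtain ⟨i, rfl⟩ := extremePoints_convexHull_subset hx'
        exact mem_image_of_mem p ((hiff i).1 hx)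
      · rintro ⟨j, hj, rfl⟩
        exact ⟨(hiff j).2 hj, hext j⟩
    refine ⟨_, ⟨hexp, ?_, ?_⟩, hvert, ?_⟩
    · obtain ⟨i, hi⟩ := (ne_univ_iff_exists_notMem J).1 hJuniv
      exact fun h => hi ((hiff i).1 (h.symm.subset (hmem i)))
    · exact hJ.elim fun j hj => ⟨p j, (hiff j).2 hj⟩
    · rw [setDim_eq_finrank_vectorSpan_vertSet (finite_range p) hexp, hvert]
      exact (finrank_vectorSpan_image_add_one_iff hp hJ).2 hind

theorem affineIndependent_iff_linearIndependent_prod_one {ι E : Type*} [AddCommGroup E]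
    [Module ℝ E] {p : ι → E} :
    AffineIndependent ℝ p ↔ LinearIndependent ℝ fun i => (p i, (1 : ℝ)) := by
  rw [affineIndependent_iff, linearIndependent_iff']
  refine forall₂_congr fun s w => ?_
  rw [← and_imp]
  refine imp_congr_left ?_
  simp [Prod.ext_iff, Prod.fst_sum, Prod.snd_sum, and_comm]

open Filter Topology in
/-- Linear independence of a subfamily and a functional supporting the whole family exactly along
that subfamily both persist under small perturbations of a finite family. -/
theorem eventually_exists_supporting {ι W : Type*} [Finite ι] [NormedAddCommGroup W]
    [NormedSpace ℝ W] [FiniteDimensional ℝ W] {q : ℝ → ι → W} (hq : Continuous q) {J : Set ι}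
    (hind : LinearIndependent ℝ fun j : J => q 0 j) (L : W →ₗ[ℝ] ℝ)
    (hJ : ∀ j ∈ J, L (q 0 j) = 0) (hneg : ∀ i ∉ J, L (q 0 i) < 0) :
    ∀ᶠ ζ in 𝓝 0, (LinearIndependent ℝ fun j : J => q ζ j) ∧
      ∃ L' : W →ₗ[ℝ] ℝ, (∀ j ∈ J, L' (q ζ j) = 0) ∧ ∀ i ∉ J, L' (q ζ i) < 0 := by
  classical
  have := Fintype.ofFinite J
  have hqi : ∀ i, Continuous fun ζ => q ζ i := fun i => (continuous_apply i).comp hq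
  obtain ⟨g, hg⟩ := (Fintype.linearCombination ℝ fun j : J => q 0 j).exists_leftInverse_of_injective
    (LinearMap.ker_eq_bot.2 hind.fintypeLinearCombination_injective)
  have hg' : ∀ j : J, g (q 0 j) = Pi.single j 1 := fun j => by
    simpa using LinearMap.congr_fun hg (Pi.single j 1)
  have hgc : Continuous g := g.continuous_of_finiteDimensional
  have hLc : Continuous L := L.continuous_of_finiteDimensional
  let M : ℝ → Matrix J J ℝ := fun ζ => Matrix.of fun k => g (q ζ k)
  let v : ℝ → J → ℝ := fun ζ k => L (q ζ k)
  let L' : ℝ → W →ₗ[ℝ] ℝ := fun ζ =>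
    (M ζ).det • L - (dotProductBilin ℝ ℝ ((M ζ).adjugate.mulVec (v ζ))).comp g
  have hM : Continuous M := continuous_matrix fun k j =>
    (continuous_apply j).comp (hgc.comp (hqi k))
  have hv : Continuous v := continuous_pi fun k => hLc.comp (hqi k)
  have hM0 : M 0 = 1 := by
    ext k j
    simp [M, hg', Matrix.one_apply, Pi.single_apply, eq_comm]
  have hv0 : v 0 = 0 := funext fun k => hJ k k.2
  have hL'apply : ∀ ζ w, L' ζ w =
      (M ζ).det * L w - (M ζ).adjugate.mulVec (v ζ) ⬝ᵥ g w := fun ζ w => rfl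
  have hdet : ∀ᶠ ζ in 𝓝 0, (M ζ).det ≠ 0 :=
    hM.matrix_det.continuousAt.eventually_ne (by simp [hM0])
  have hL'neg : ∀ᶠ ζ in 𝓝 0, ∀ i, i ∉ J → L' ζ (q ζ i) < 0 := by
    refine eventually_all.2 fun i => ?_
    by_cases hi : i ∈ J
    · simp [hi]
    have hc : Continuous fun ζ => L' ζ (q ζ i) := by
      simp only [hL'apply]
      exact (hM.matrix_det.mul (hLc.comp (hqi i))).sub
        ((hM.matrix_adjugate.matrix_mulVec hv).dotProduct (hgc.comp (hqi i)))
    have h0 : L' 0 (q 0 i) < 0 := by simpa [hL'apply, hM0, hv0] using hneg i hi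
    exact (hc.continuousAt.eventually_lt continuousAt_const h0).mono fun ζ h _ => h
  filter_upwards [hdet, hL'neg] with ζ hζ hζneg
  refine ⟨.of_comp g (Matrix.linearIndependent_rows_of_det_ne_zero hζ), L' ζ, fun j hj => ?_, hζneg⟩
  have h := congrFun (Matrix.mulVec_mulVec (v ζ) (M ζ) (M ζ).adjugate) ⟨j, hj⟩
  rw [Matrix.mul_adjugate, Matrix.smul_mulVec, Matrix.one_mulVec] at h
  rw [hL'apply, dotProduct_comm, sub_eq_zero]
  exact h.symm

open Filter Topology in
/-- A simplex face of a polytope persists under small perturbations of the vertices. -/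
theorem IsSimplexFaceVertexSet.eventually {N : ℕ} {ι : Type*} [Finite ι] {p : ℝ → ι → Euc N}
    (hcont : Continuous p) (hp : ∀ ζ, (p ζ).Injective)
    (hext : ∀ ζ i, p ζ i ∈ vertSet (convexHull ℝ (range (p ζ))))
    {J : Set ι} (hJ : J.Nonempty)
    (h : IsSimplexFaceVertexSet (convexHull ℝ (range (p 0))) (p 0 '' J)) :
    ∀ᶠ ζ in 𝓝 0, IsSimplexFaceVertexSet (convexHull ℝ (range (p ζ))) (p ζ '' J) := by
  obtain ⟨hJuniv, hind, l, c, hlJ, hlc⟩ :=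
    (isSimplexFaceVertexSet_image_iff (hp 0) (hext 0) hJ).1 h
  have hq : Continuous fun ζ i => (p ζ i, (1 : ℝ)) := continuous_pi fun i =>
    ((continuous_apply i).comp hcont).prodMk continuous_const
  have key := eventually_exists_supporting hq (J := J)
    (affineIndependent_iff_linearIndependent_prod_one.1 hind)
    (l.toLinearMap.coprod ((-c) • LinearMap.id))
    (fun j hj => by simp [hlJ j hj]) (fun i hi => by simpa using hlc i hi)
  filter_upwards [key] with ζ ⟨hind', L', hL'J, hL'neg⟩
  have hL' : ∀ x, L' (x, 1) = L' (x, 0) + L' (0, 1) := fun x => by simp [← map_add]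
  refine (isSimplexFaceVertexSet_image_iff (hp ζ) (hext ζ) hJ).2
    ⟨hJuniv, affineIndependent_iff_linearIndependent_prod_one.2 hind',
      (L'.comp (LinearMap.inl ℝ _ ℝ)).toContinuousLinearMap, -L' (0, 1),
      fun j hj => ?_, fun i hi => ?_⟩
  · have := hL'J j hj
    rw [hL'] at this
    simpa using eq_neg_of_add_eq_zero_left this
  · have := hL'neg i hi
    rw [hL'] at this
    exact show L' (p ζ i, 0) < -L' (0, 1) by linarith

open Filter Topology in
/-- Bineighborliness persists under small perturbations of the vertices. -/
theorem PolytopeBineighborly.eventually {N k : ℕ} {ι κ : Type*} [Finite ι] [Finite κ] [Nonempty κ]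
    {p : ℝ → ι → Euc N} {q : ℝ → κ → Euc N} (hcont : Continuous fun ζ => Sum.elim (p ζ) (q ζ))
    (hinj : ∀ ζ, (Sum.elim (p ζ) (q ζ)).Injective)
    (hext : ∀ ζ i, Sum.elim (p ζ) (q ζ) i ∈ vertSet (convexHull ℝ (range (p ζ) ∪ range (q ζ))))
    (h : PolytopeBineighborly (convexHull ℝ (range (p 0) ∪ range (q 0))) (range (p 0)) k) :
    ∀ᶠ ζ in 𝓝 0,
      PolytopeBineighborly (convexHull ℝ (range (p ζ) ∪ range (q ζ))) (range (p ζ)) k := by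
  simp only [← Sum.elim_range] at hext h ⊢
  have hvert : ∀ ζ, vertSet (convexHull ℝ (range (Sum.elim (p ζ) (q ζ)))) =
      range (Sum.elim (p ζ) (q ζ)) := fun ζ =>
    extremePoints_convexHull_subset.antisymm (range_subset_iff.2 (hext ζ))
  have hdiff : ∀ ζ, range (Sum.elim (p ζ) (q ζ)) \ range (p ζ) = range (q ζ) := fun ζ => by
    rw [Sum.elim_range, union_sdiff_left, sdiff_eq_left, disjoint_right]
    rintro _ ⟨i, rfl⟩ ⟨j, hj⟩
    exact Sum.inl_ne_inr (hinj ζ (a₁ := .inl i) (a₂ := .inr j) hj.symm)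
  have himage : ∀ ζ (A : Set ι) (B : Set κ),
      Sum.elim (p ζ) (q ζ) '' (Sum.inl '' A ∪ Sum.inr '' B) = p ζ '' A ∪ q ζ '' B := fun ζ A B => by
    simp [image_union, image_image]
  have hpinj : ∀ ζ, (p ζ).Injective := fun ζ => (hinj ζ).comp Sum.inl_injective
  have hqinj : ∀ ζ, (q ζ).Injective := fun ζ => (hinj ζ).comp Sum.inr_injective
  obtain ⟨hne, -, hface⟩ := h
  have := range_nonempty_iff_nonempty.1 hne
  rw [hvert, hdiff] at hface
  have key : ∀ᶠ ζ in 𝓝 0, ∀ (A : Set ι) (B : Set κ), A.Nonempty → B.Nonempty →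
      A.ncard + B.ncard ≤ k → IsSimplexFaceVertexSet
        (convexHull ℝ (range (Sum.elim (p ζ) (q ζ)))) (p ζ '' A ∪ q ζ '' B) := by
    refine eventually_all.2 fun A => eventually_all.2 fun B => ?_
    by_cases hAB : A.Nonempty ∧ B.Nonempty ∧ A.ncard + B.ncard ≤ k
    · obtain ⟨hA, hB, hk⟩ := hAB
      have h0 := hface (p 0 '' A) (q 0 '' B) (hA.image _) (hB.image _) (image_subset_range _ _)
        (image_subset_range _ _)
        (by rwa [ncard_image_of_injective _ (hpinj 0), ncard_image_of_injective _ (hqinj 0)])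
      rw [← himage] at h0
      filter_upwards [h0.eventually hcont hinj hext ((hA.image _).inl)] with ζ hζ _ _ _
      rwa [← himage]
    · exact .of_forall fun ζ hA hB hk => absurd ⟨hA, hB, hk⟩ hAB
  filter_upwards [key] with ζ hζ
  refine ⟨range_nonempty _, ?_, ?_⟩
  · rw [hvert, ssubset_iff_subset_ne, Sum.elim_range]
    refine ⟨subset_union_left, fun heq => ?_⟩
    have hd := hdiff ζ
    rw [Sum.elim_range, ← heq, Set.sdiff_self] at hd
    exact (range_nonempty (q ζ)).ne_empty hd.symm
  · intro S₁ S₂ hS₁ hS₂ hS₁p hS₂q hk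
    rw [hvert, hdiff] at hS₂q
    obtain ⟨A, rfl⟩ := subset_range_iff_exists_image_eq.1 hS₁p
    obtain ⟨B, rfl⟩ := subset_range_iff_exists_image_eq.1 hS₂q
    rw [ncard_image_of_injective _ (hpinj ζ), ncard_image_of_injective _ (hqinj ζ)] at hk
    exact hζ A B hS₁.of_image hS₂.of_image hk

theorem continuous_gamma1 (d : ℕ) (t : ℝ) : Continuous fun ζ => gamma1 d ζ t :=
  continuous_pi fun i => by unfold gamma1; split_ifs <;> fun_prop

theorem continuous_gamma2 (d : ℕ) (s : ℝ) : Continuous fun ζ => gamma2 d ζ s :=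
  continuous_pi fun i => by unfold gamma2; split_ifs <;> fun_prop

/-- Points on the curves `gamma1` and `gamma2` are in convex position. -/
theorem elim_gamma_mem_vertSet {d : ℕ} (hd : 3 ≤ d) {ι κ : Type*} [Finite ι] [Finite κ]
    {t : ι → ℝ} {s : κ → ℝ} (ht : t.Injective) (hs : s.Injective) (ζ : ℝ) (i : ι ⊕ κ) :
    Sum.elim (fun i => gamma1 d ζ (t i)) (fun j => gamma2 d ζ (s j)) i ∈
      vertSet (convexHull ℝ
        ((range fun i => gamma1 d ζ (t i)) ∪ range fun j => gamma2 d ζ (s j))) := by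
  let x (m : ℕ) (hm : m < d + 1) : StrongDual ℝ (Euc (d + 1)) := ContinuousLinearMap.proj ⟨m, hm⟩
  have hd0 : d ≠ 0 := by omega
  have hd1 : d ≠ 1 := by omega
  have h2 : 2 ≠ d := by omega
  rw [← Sum.elim_range]
  rcases i with i | j
  · obtain ⟨M, hM⟩ := (finite_range fun j =>
      2 * t i * (ζ * s j ^ d) - s j ^ 2 - t i ^ 2).bddAbove
    refine mem_vertSet_convexHull_range
      ((2 * t i) • x 0 (by omega) - x 2 (by omega) - (M + 1) • x d (by omega)) (Sum.inl i) ?_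
    rintro (i' | j) hne
    · have hlt : 0 < (t i' - t i) ^ 2 :=
        sq_pos_of_ne_zero (sub_ne_zero.2 fun h => hne (congrArg Sum.inl (ht h)))
      simp [x, gamma1, h2, hd0, hd1]
      nlinarith
    · have := hM (mem_range_self j)
      simp [x, gamma1, gamma2, h2, hd0, hd1] at this ⊢
      nlinarith
  · obtain ⟨M, hM⟩ := (finite_range fun i =>
      2 * s j * (ζ * t i ^ d) - t i ^ 2 - s j ^ 2).bddAbove
    refine mem_vertSet_convexHull_range
      ((2 * s j) • x 1 (by omega) - x 2 (by omega) + (M + 1) • x d (by omega)) (Sum.inr j) ?_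
    rintro (i | j') hne
    · have := hM (mem_range_self i)
      simp [x, gamma1, gamma2, h2, hd0, hd1] at this ⊢
      nlinarith
    · have hlt : 0 < (s j' - s j) ^ 2 :=
        sq_pos_of_ne_zero (sub_ne_zero.2 fun h => hne (congrArg Sum.inr (hs h)))
      simp [x, gamma2, h2, hd0, hd1]
      nlinarith

theorem elim_gamma_injective {d : ℕ} (hd : 3 ≤ d) {ι κ : Type*}
    {t : ι → ℝ} {s : κ → ℝ} (ht : t.Injective) (hs : s.Injective) (ζ : ℝ) :
    (Sum.elim (fun i => gamma1 d ζ (t i)) (fun j => gamma2 d ζ (s j))).Injective := by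
  have hd0 : d ≠ 0 := by omega
  have hd1 : d ≠ 1 := by omega
  refine Function.Injective.sumElim (fun i i' h => ht ?_) (fun j j' h => hs ?_) fun i j h => ?_
  · simpa [gamma1] using congrFun h ⟨0, by omega⟩
  · simpa [gamma2] using congrFun h ⟨1, by omega⟩
  · simpa [gamma1, gamma2, hd0, hd1] using congrFun h ⟨d, by omega⟩

/-- if the unperturbed Cayley-type polytope is `(U1; ⌊(d+1)/2⌋)`-bineighborly
for the parameter `τ*`, then there is a sufficiently small perturbation `ζ > 0` such that
the perturbed polytope `P = CH(V1 ∪ V2)` is `(V1; ⌊(d+1)/2⌋)`-bineighborly. -/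
theorem statement_15 (d : ℕ) (hd : 3 ≤ d) (hdodd : Odd d)
    (n1 n2 : ℕ) (hn1 : 1 ≤ n1) (hn2 : 1 ≤ n2)
    (α : Fin n1 → ℝ) (β : Fin n2 → ℝ)
    (hα0 : ∀ i, 0 < α i) (hα : StrictMono α)
    (hβ0 : ∀ j, 0 < β j) (hβ : StrictMono β)
    (τs : ℝ) (hτ : 0 < τs)
    (hbase : PolytopeBineighborly
      (convexHull ℝ
        ((Set.range fun i : Fin n1 => gamma1 d 0 (α i * τs)) ∪
          (Set.range fun j : Fin n2 => gamma2 d 0 (β j))))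
      (Set.range fun i : Fin n1 => gamma1 d 0 (α i * τs)) ((d + 1) / 2)) :
    ∃ ζ : ℝ, 0 < ζ ∧
      PolytopeBineighborly
        (convexHull ℝ
          ((Set.range fun i : Fin n1 => gamma1 d ζ (α i * τs)) ∪
            (Set.range fun j : Fin n2 => gamma2 d ζ (β j))))
        (Set.range fun i : Fin n1 => gamma1 d ζ (α i * τs)) ((d + 1) / 2) := by
  have := Fin.pos_iff_nonempty.1 hn2
  have hα' : Function.Injective fun i => α i * τs :=
    (mul_left_injective₀ hτ.ne').comp hα.injective
  have hcont : Continuous fun ζ => Sum.elim (fun i => gamma1 d ζ (α i * τs))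
      (fun j => gamma2 d ζ (β j)) := continuous_pi fun i => by
    rcases i with i | j
    · exact continuous_gamma1 d _
    · exact continuous_gamma2 d _
  have hev := hbase.eventually (p := fun ζ i => gamma1 d ζ (α i * τs))
    (q := fun ζ j => gamma2 d ζ (β j)) hcont (elim_gamma_injective hd hα' hβ.injective)
    (elim_gamma_mem_vertSet hd hα' hβ.injective)
  obtain ⟨ζ, hζ, hpos⟩ :=
    ((hev.filter_mono nhdsWithin_le_nhds).and (self_mem_nhdsWithin (s := Ioi (0 : ℝ)))).exists
  exact ⟨ζ, hpos, hζ⟩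
end
end
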